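/- arXiv:math/0602165 — 4 statements merged into one kernel-verified Lean document; each statement's English description precedes it below -/
import Mathlib

section
/- Let (W,S) be an irreducible Coxeter system with W infinite, let s ∈ S, and put I = S ∖ {s}. Then the only elements of W that normalize the standard parabolic subgroup W_I are the elements of W_I: if w ∈ W satisfies w W_I w⁻¹ = W_I, then w ∈ W_I. -/
namespace CoxGeom

open Module

variable {B W : Type*} [Group W] {M : CoxeterMatrix B}

/-- The Cartan-type coefficient `-2 cos (π / m)`. -/
noncomputable def kc (M : CoxeterMatrix B) (a b : B) : ℝ := -2 * Real.cos (Real.pi / (M a b : ℝ))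

/-- The simple coroot. -/
noncomputable def cr (M : CoxeterMatrix B) (a : B) : Dual ℝ (B →₀ ℝ) :=
  Finsupp.linearCombination ℝ (fun b => kc M a b)

/-- The simple root. -/
noncomputable def al (a : B) : B →₀ ℝ := Finsupp.single a 1

theorem cr_al (a b : B) : cr M a (al b) = kc M a b := by
  simp [cr, al]

theorem kc_symm (a b : B) : kc M a b = kc M b a := by
  simp [kc, M.symmetric a b]

theorem kc_self (a : B) : kc M a a = 2 := by
  simp [kc]

theorem cr_self (a : B) : cr M a (al a) = 2 := by rw [cr_al, kc_self]

theorem M_ge {a b : B} (h : a ≠ b) (h0 : M a b ≠ 0) : 2 ≤ M a b := by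
  have := M.off_diagonal a b h
  omega

theorem kc_ne_zero {a b : B} (h : a ≠ b) (h2 : M a b ≠ 2) : kc M a b ≠ 0 := by
  unfold kc
  have : 0 < Real.cos (Real.pi / (M a b : ℝ)) := by
    by_cases h0 : M a b = 0
    · simp [h0]
    · have h3 : 3 ≤ M a b := by have := M_ge h h0; omega
      have h3' : (3 : ℝ) ≤ M a b := by exact_mod_cast h3
      apply Real.cos_pos_of_mem_Ioo
      constructor
      · have : 0 ≤ Real.pi / (M a b : ℝ) := by positivity
        linarith [Real.pi_pos]
      · apply div_lt_div_of_pos_left Real.pi_pos <;> linarith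
  intro h
  linarith

/-- The simple reflection. -/
noncomputable def rf (M : CoxeterMatrix B) (a : B) : (B →₀ ℝ) ≃ₗ[ℝ] (B →₀ ℝ) :=
  Module.reflection (cr_self (M := M) a)

theorem rf_apply (a : B) (v : B →₀ ℝ) : rf M a v = v - cr M a v • al a := by
  simp [rf, Module.reflection_apply]

theorem S_sin (φ : ℝ) (n : ℤ) :
    (Polynomial.Chebyshev.S ℝ n).eval (2 * Real.cos φ) * Real.sin φ = Real.sin ((n + 1) * φ) := by
  rw [← Polynomial.Chebyshev.U_real_cos, ← Polynomial.Chebyshev.S_comp_two_mul_X]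
  simp

theorem rf_rel (a b : B) : (rf M a * rf M b) ^ M a b = 1 := by
  by_cases hab : a = b
  · subst hab
    ext1 v
    simp [LinearEquiv.mul_apply, rf, Module.involutive_reflection (cr_self (M := M) a) v]
  by_cases h0 : M a b = 0
  · simp [h0]
  by_cases h2 : M a b = 2
  · have k0 : kc M a b = 0 := by simp [kc, h2]
    have k0' : kc M b a = 0 := by rw [kc_symm, k0]
    rw [h2]
    refine LinearEquiv.ext fun v => ?_
    simp only [pow_two, LinearEquiv.mul_apply, rf_apply, map_sub, map_smul, cr_al, k0, k0', kc_self,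
      LinearEquiv.coe_one, id]
    module
  have h3 : 3 ≤ M a b := by have := M_ge hab h0; omega
  have h3' : (3 : ℝ) ≤ M a b := by exact_mod_cast h3
  set m := M a b with hm
  have hm0 : (m : ℝ) ≠ 0 := by linarith
  set φ : ℝ := 2 * Real.pi / m with hφ
  have hmφ : (m : ℝ) * φ = 2 * Real.pi := by rw [hφ]; field_simp
  have hs : Real.sin φ ≠ 0 := by
    apply ne_of_gt
    apply Real.sin_pos_of_pos_of_lt_pi
    · rw [hφ]; have := Real.pi_pos; positivity
    · rw [hφ, div_lt_iff₀ (by linarith)]; nlinarith [Real.pi_pos]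
  have ht : 2 * Real.cos φ = cr M a (al b) * cr M b (al a) - 2 := by
    rw [cr_al, cr_al, kc_symm b a, kc, ← hm, hφ, mul_div_assoc, Real.cos_two_mul]
    ring
  refine LinearEquiv.ext fun v => ?_
  have key := Module.reflection_mul_reflection_pow_apply (cr_self (M := M) a) (cr_self (M := M) b)
    m v (2 * Real.cos φ) ht
  unfold rf
  rw [key]
  obtain ⟨j, hj | hj⟩ := Nat.even_or_odd' m
  · have e1 : ((m : ℤ) - 2) / 2 = j - 1 := by omega
    have e2 : ((m : ℤ) - 1) / 2 = j - 1 := by omega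
    have z : (Polynomial.Chebyshev.S ℝ ((j : ℤ) - 1)).eval (2 * Real.cos φ) = 0 := by
      have := S_sin φ ((j : ℤ) - 1)
      have e : (((j : ℤ) - 1 : ℤ) + 1 : ℝ) * φ = Real.pi := by
        have : (m : ℝ) = 2 * j := by exact_mod_cast hj
        rw [this] at hmφ
        push_cast
        linarith
      rw [e, Real.sin_pi] at this
      exact (mul_eq_zero.mp this).resolve_right hs
    rw [e1, e2, z]
    simp
  · have e1 : ((m : ℤ) - 2) / 2 = j - 1 := by omega
    have e2 : ((m : ℤ) - 1) / 2 = j := by omega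
    have e3 : ((m : ℤ) - 3) / 2 = j - 1 := by omega
    have e4 : (m : ℤ) / 2 = j := by omega
    have z : (Polynomial.Chebyshev.S ℝ (j : ℤ)).eval (2 * Real.cos φ) +
        (Polynomial.Chebyshev.S ℝ ((j : ℤ) - 1)).eval (2 * Real.cos φ) = 0 := by
      have h1 := S_sin φ ((j : ℤ) - 1)
      have h2 := S_sin φ (j : ℤ)
      have e : ((j : ℤ) + 1 : ℝ) * φ = 2 * Real.pi - (((j : ℤ) - 1 : ℤ) + 1 : ℝ) * φ := by
        have : (m : ℝ) = 2 * j + 1 := by exact_mod_cast hj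
        rw [this] at hmφ
        push_cast
        linarith
      rw [e, Real.sin_two_pi_sub, ← h1] at h2
      have : ((Polynomial.Chebyshev.S ℝ (j : ℤ)).eval (2 * Real.cos φ) +
        (Polynomial.Chebyshev.S ℝ ((j : ℤ) - 1)).eval (2 * Real.cos φ)) * Real.sin φ = 0 := by
        linarith
      exact (mul_eq_zero.mp this).resolve_right hs
    rw [e1, e2, e3, e4, z]
    simp

/-- The geometric representation. -/
noncomputable def rho (cs : CoxeterSystem M W) : W →* ((B →₀ ℝ) ≃ₗ[ℝ] (B →₀ ℝ)) :=
  cs.lift ⟨rf M, fun a b => rf_rel a b⟩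

theorem rho_simple (cs : CoxeterSystem M W) (a : B) : rho cs (cs.simple a) = rf M a :=
  cs.lift_apply_simple _ a

theorem rho_mul (cs : CoxeterSystem M W) (w w' : W) (v : B →₀ ℝ) :
    rho cs (w * w') v = rho cs w (rho cs w' v) := by
  rw [map_mul, LinearEquiv.mul_apply]

theorem rho_simple_al (cs : CoxeterSystem M W) (a : B) : rho cs (cs.simple a) (al a) = - al a := by
  rw [rho_simple, rf_apply, cr_self]; module

/-- The dihedral coefficient sequence. -/
noncomputable def cc (p : ℝ) : ℕ → ℝ
  | 0 => 0
  | 1 => 1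
  | n + 2 => p * cc p (n + 1) - cc p n

theorem cc_two (n : ℕ) : cc 2 n = n ∧ cc 2 (n + 1) = n + 1 := by
  induction n with
  | zero => simp [cc]
  | succ n ih =>
    refine ⟨by push_cast; exact ih.2, ?_⟩
    rw [cc, ih.1, ih.2]; push_cast; ring

theorem cc_sin (θ : ℝ) (n : ℕ) : cc (2 * Real.cos θ) n * Real.sin θ = Real.sin (n * θ) ∧
    cc (2 * Real.cos θ) (n + 1) * Real.sin θ = Real.sin ((n + 1) * θ) := by
  induction n with
  | zero => simp [cc]
  | succ n ih =>
    refine ⟨by push_cast; exact ih.2, ?_⟩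
    rw [cc, sub_mul, mul_assoc, ih.1, ih.2]
    have e1 : (n : ℝ) * θ = (n + 1) * θ - θ := by ring
    have e2 : ((n + 1 : ℕ) + 1 : ℝ) * θ = (n + 1) * θ + θ := by push_cast; ring
    rw [e1, e2, Real.sin_add, Real.sin_sub]
    ring

theorem cc_nonneg {a b : B} (hab : a ≠ b) (n : ℕ) (hn : M a b ≠ 0 → n ≤ M a b) :
    0 ≤ cc (- kc M a b) n := by
  by_cases h0 : M a b = 0
  · have : - kc M a b = 2 := by simp [kc, h0]
    rw [this, (cc_two n).1]; positivity
  · have h2 := M_ge hab h0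
    have h2' : (2 : ℝ) ≤ M a b := by exact_mod_cast h2
    have hn' : (n : ℝ) ≤ M a b := by exact_mod_cast hn h0
    set θ := Real.pi / (M a b : ℝ) with hθ
    have hk : - kc M a b = 2 * Real.cos θ := by simp [kc, hθ]
    have hmθ : (M a b : ℝ) * θ = Real.pi := by rw [hθ]; field_simp
    have hθ0 : 0 < θ := by rw [hθ]; have := Real.pi_pos; positivity
    have hs : 0 < Real.sin θ := by
      apply Real.sin_pos_of_pos_of_lt_pi hθ0
      nlinarith
    have h := (cc_sin θ n).1
    have : 0 ≤ Real.sin (n * θ) := by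
      apply Real.sin_nonneg_of_nonneg_of_le_pi
      · positivity
      · rw [← hmθ]; gcongr
    rw [hk]
    rw [← h] at this
    exact nonneg_of_mul_nonneg_left this hs

theorem alt_apply (cs : CoxeterSystem M W) (a b : B) (n : ℕ) :
    rho cs (cs.wordProd (CoxeterSystem.alternatingWord a b n)) (al a) =
      if Even n then cc (- kc M a b) (n + 1) • al a + cc (- kc M a b) n • al b
      else cc (- kc M a b) n • al a + cc (- kc M a b) (n + 1) • al b := by
  induction n with
  | zero => simp [CoxeterSystem.alternatingWord, cc]
  | succ n ih =>
    rw [CoxeterSystem.alternatingWord_succ', CoxeterSystem.wordProd_cons, rho_mul, ih, rho_simple]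
    by_cases h : Even n
    · have h' : ¬ Even (n + 1) := by simp [Nat.even_add_one, h]
      simp only [h, h', if_true, if_false, rf_apply, map_add, map_smul, cr_al, kc_self,
        kc_symm b a, cc, smul_eq_mul]
      module
    · have h' : Even (n + 1) := by simp [Nat.even_add_one, h]
      simp only [h, h', if_true, if_false, rf_apply, map_add, map_smul, cr_al, kc_self,
        kc_symm b a, cc, smul_eq_mul]
      module

theorem al_nonneg (a : B) : 0 ≤ (al a : B →₀ ℝ) := by
  intro b
  classical
  simp only [al, Finsupp.single_apply, Finsupp.coe_zero, Pi.zero_apply]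
  split_ifs <;> norm_num

theorem al_self (a : B) : (al a : B →₀ ℝ) a = 1 := by simp [al]

theorem smul_nn {c : ℝ} {v : B →₀ ℝ} (hc : 0 ≤ c) (hv : 0 ≤ v) : 0 ≤ c • v := by
  intro b
  have := hv b
  simp only [Finsupp.coe_zero, Pi.zero_apply, Finsupp.coe_smul, Pi.smul_apply, smul_eq_mul] at *
  positivity

theorem add_nn {u v : B →₀ ℝ} (hu : 0 ≤ u) (hv : 0 ≤ v) : 0 ≤ u + v := by
  intro b
  have := hv b
  have := hu b
  simp only [Finsupp.coe_zero, Pi.zero_apply, Finsupp.coe_add, Pi.add_apply] at *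
  linarith

theorem pos_of_not_descent (cs : CoxeterSystem M W) (N : ℕ) : ∀ (w : W) (a : B),
    cs.length w = N → ¬ cs.IsRightDescent w a → 0 ≤ rho cs w (al a) := by
  induction N using Nat.strong_induction_on with
  | _ N IH =>
  intro w a hN ha
  by_cases hw1 : w = 1
  · subst hw1
    simpa using al_nonneg a
  obtain ⟨b, hb⟩ := cs.exists_rightDescent_of_ne_one hw1
  have hab : a ≠ b := by rintro rfl; exact ha hb
  classical
  let P : ℕ → Prop := fun n => ∃ v, w = v * cs.wordProd (CoxeterSystem.alternatingWord a b n) ∧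
    cs.length w = cs.length v + n
  have hP1 : P 1 := by
    refine ⟨w * cs.simple b, ?_, ?_⟩
    · simp [CoxeterSystem.alternatingWord]
    · exact (cs.isRightDescent_iff.mp hb).symm
  have hPle : ∀ n, P n → n ≤ N := by
    rintro n ⟨v, -, h⟩
    omega
  have hN1 : 1 ≤ N := hPle 1 hP1
  set n := Nat.findGreatest P N with hn
  have hPn : P n := Nat.findGreatest_spec hN1 hP1
  have hmax : ¬ P (n + 1) := by
    intro h
    have := Nat.le_findGreatest (hPle _ h) h
    omega
  have hn1 : 1 ≤ n := Nat.le_findGreatest hN1 hP1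
  clear_value n
  obtain ⟨v, hwv, hlen⟩ := hPn
  obtain ⟨k, rfl⟩ : ∃ k, n = k + 1 := ⟨n - 1, by omega⟩
  -- first and extending letters
  set x := if Even k then b else a with hx
  set y := if Even (k + 1) then b else a with hy
  have hvx : ¬ cs.IsRightDescent v x := by
    intro h
    rw [CoxeterSystem.isRightDescent_iff] at h
    rw [CoxeterSystem.alternatingWord_succ', CoxeterSystem.wordProd_cons, ← mul_assoc, ← hx] at hwv
    have h1 := cs.length_mul_le (v * cs.simple x)
      (cs.wordProd (CoxeterSystem.alternatingWord a b k))
    rw [← hwv] at h1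
    have h2 := cs.length_wordProd_le (CoxeterSystem.alternatingWord a b k)
    rw [CoxeterSystem.length_alternatingWord] at h2
    omega
  have hvy : ¬ cs.IsRightDescent v y := by
    intro h
    apply hmax
    refine ⟨v * cs.simple y, ?_, ?_⟩
    · rw [CoxeterSystem.alternatingWord_succ' a b (k + 1), CoxeterSystem.wordProd_cons, ← hy,
        ← mul_assoc, cs.simple_mul_simple_cancel_right]
      exact hwv
    · rw [CoxeterSystem.isRightDescent_iff] at h
      omega
  have hva : ¬ cs.IsRightDescent v a ∧ ¬ cs.IsRightDescent v b := by
    by_cases hk : Even k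
    · have hk' : ¬ Even (k + 1) := by simp [Nat.even_add_one, hk]
      simp only [hk, hk', if_true, if_false] at hx hy
      rw [hx] at hvx; rw [hy] at hvy
      exact ⟨hvy, hvx⟩
    · have hk' : Even (k + 1) := by simp [Nat.even_add_one, hk]
      simp only [hk, hk', if_true, if_false] at hx hy
      rw [hx] at hvx; rw [hy] at hvy
      exact ⟨hvx, hvy⟩
  have hpa := IH (cs.length v) (by omega) v a rfl hva.1
  have hpb := IH (cs.length v) (by omega) v b rfl hva.2
  have hlt : M a b ≠ 0 → k + 1 < M a b := by
    intro h0
    by_contra hge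
    push Not at hge
    rcases hge.lt_or_eq with hlt | heq
    · apply cs.not_isReduced_alternatingWord a b h0 hlt
      unfold CoxeterSystem.IsReduced
      apply le_antisymm (cs.length_wordProd_le _)
      rw [CoxeterSystem.length_alternatingWord]
      have := cs.length_mul_le v (cs.wordProd (CoxeterSystem.alternatingWord a b (k + 1)))
      rw [← hwv] at this
      omega
    · have hbr := cs.wordProd_braidWord_eq a b
      unfold CoxeterSystem.braidWord at hbr
      rw [← M.symmetric a b, heq] at hbr
      rw [hbr, CoxeterSystem.alternatingWord_succ, CoxeterSystem.wordProd_concat] at hwv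
      apply ha
      unfold CoxeterSystem.IsRightDescent
      have : w * cs.simple a = v * cs.wordProd (CoxeterSystem.alternatingWord a b k) := by
        rw [hwv, ← mul_assoc, cs.simple_mul_simple_cancel_right]
      rw [this]
      have h1 := cs.length_mul_le v (cs.wordProd (CoxeterSystem.alternatingWord a b k))
      have h2 := cs.length_wordProd_le (CoxeterSystem.alternatingWord a b k)
      rw [CoxeterSystem.length_alternatingWord] at h2
      omega
  have c1 := cc_nonneg hab (k + 1) (fun h => (hlt h).le)
  have c2 := cc_nonneg hab (k + 1 + 1) (fun h => hlt h)
  rw [hwv, rho_mul, alt_apply]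
  split_ifs
  · rw [map_add, map_smul, map_smul]
    exact add_nn (smul_nn c2 hpa) (smul_nn c1 hpb)
  · rw [map_add, map_smul, map_smul]
    exact add_nn (smul_nn c1 hpa) (smul_nn c2 hpb)

theorem neg_of_descent (cs : CoxeterSystem M W) (w : W) (a : B) (h : cs.IsRightDescent w a) :
    rho cs w (al a) ≤ 0 := by
  have h1 : ¬ cs.IsRightDescent (w * cs.simple a) a :=
    cs.isRightDescent_iff_not_isRightDescent_mul.mp h
  have := pos_of_not_descent cs _ _ a rfl h1
  rw [rho_mul, rho_simple_al, map_neg] at this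
  intro b
  have := this b
  simp only [Finsupp.coe_zero, Pi.zero_apply, Finsupp.coe_neg, Pi.neg_apply] at *
  linarith

/-- The set of roots. -/
def roots (cs : CoxeterSystem M W) : Set (B →₀ ℝ) := {v | ∃ w a, v = rho cs w (al a)}

theorem roots_stable (cs : CoxeterSystem M W) (w : W) {v : B →₀ ℝ} (h : v ∈ roots cs) :
    rho cs w v ∈ roots cs := by
  obtain ⟨w', a, rfl⟩ := h
  exact ⟨w * w', a, (rho_mul ..).symm⟩

theorem root_sign (cs : CoxeterSystem M W) {v : B →₀ ℝ} (h : v ∈ roots cs) : 0 ≤ v ∨ v ≤ 0 := by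
  obtain ⟨w, a, rfl⟩ := h
  by_cases hd : cs.IsRightDescent w a
  · exact Or.inr (neg_of_descent cs w a hd)
  · exact Or.inl (pos_of_not_descent cs _ w a rfl hd)

theorem root_neg (cs : CoxeterSystem M W) {v : B →₀ ℝ} (h : v ∈ roots cs) : -v ∈ roots cs := by
  obtain ⟨w, a, rfl⟩ := h
  exact ⟨w * cs.simple a, a, by rw [rho_mul, rho_simple_al, map_neg]⟩

theorem faithful (cs : CoxeterSystem M W) {w : W} (h : ∀ v, rho cs w v = v) : w = 1 := by
  by_contra hw
  obtain ⟨a, ha⟩ := cs.exists_rightDescent_of_ne_one hw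
  have := neg_of_descent cs w a ha a
  rw [h, al_self] at this
  simp only [Finsupp.coe_zero, Pi.zero_apply] at this
  linarith

/-- The invariant bilinear form. -/
noncomputable def bf (M : CoxeterMatrix B) : (B →₀ ℝ) →ₗ[ℝ] Dual ℝ (B →₀ ℝ) :=
  Finsupp.linearCombination ℝ (fun a => cr M a)

theorem bf_al (a : B) : bf M (al a) = cr M a := by simp [bf, al]

theorem bf_al_right (a : B) (u : B →₀ ℝ) : bf M u (al a) = cr M a u := by
  induction u using Finsupp.induction_linear with
  | zero => simp
  | add f g hf hg => simp [hf, hg]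
  | single b r =>
    have : Finsupp.single b r = r • (al b : B →₀ ℝ) := by simp [al]
    rw [this, map_smul, map_smul, LinearMap.smul_apply, bf_al, cr_al, cr_al, kc_symm]

theorem bf_inv (cs : CoxeterSystem M W) (w : W) : ∀ u v, 
    bf M (rho cs w u) (rho cs w v) = bf M u v := by
  induction w using cs.simple_induction with
  | one => simp
  | mul w w' h h' => intro u v; rw [rho_mul, rho_mul, h, h']
  | simple a =>
    intro u v
    rw [rho_simple, rf_apply, rf_apply]
    simp only [map_sub, map_smul, LinearMap.sub_apply, LinearMap.smul_apply, bf_al, bf_al_right,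
      cr_self, smul_eq_mul]
    ring

theorem bf_root (cs : CoxeterSystem M W) {v : B →₀ ℝ} (h : v ∈ roots cs) : bf M v v = 2 := by
  obtain ⟨w, a, rfl⟩ := h
  rw [bf_inv, bf_al, cr_self]

theorem simple_pos (cs : CoxeterSystem M W) {v : B →₀ ℝ} (h : v ∈ roots cs) (h0 : 0 ≤ v) (a : B)
    (hne : v ≠ al a) : 0 ≤ rf M a v := by
  by_contra hneg
  have hr : rf M a v ∈ roots cs := by rw [← rho_simple cs]; exact roots_stable cs _ h
  have hle := (root_sign cs hr).resolve_left hneg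
  have hz : ∀ b, b ≠ a → v b = 0 := by
    intro b hb
    have h1 := hle b
    have h2 := h0 b
    rw [rf_apply] at h1
    simp [al, Finsupp.single_apply, hb.symm] at h1 h2
    linarith
  have hv : v = v a • al a := by
    ext b
    by_cases hb : b = a
    · subst hb; simp [al]
    · simp [hz b hb, al, Finsupp.single_apply, Ne.symm hb]
  have h2 := bf_root cs h
  rw [hv] at h2
  simp only [map_smul, LinearMap.smul_apply, bf_al, cr_self, smul_eq_mul] at h2
  have ha : 0 ≤ v a := h0 a
  have : v a = 1 := by nlinarith
  apply hne
  rw [hv, this, one_smul]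

theorem inv_finite (cs : CoxeterSystem M W) (w : W) :
    {v | v ∈ roots cs ∧ 0 ≤ v ∧ rho cs w v ≤ 0}.Finite := by
  induction w using cs.simple_induction_right with
  | one =>
    apply (Set.finite_singleton (0 : B →₀ ℝ)).subset
    rintro v ⟨-, h1, h2⟩
    exact le_antisymm (by simpa using h2) h1
  | mul_simple_right w a ih =>
    apply ((Set.finite_singleton (al a)).union
      (ih.preimage ((rf M a).injective.injOn))).subset
    rintro v ⟨h, h1, h2⟩
    by_cases hv : v = al a
    · exact Or.inl hv
    · refine Or.inr ⟨?_, simple_pos cs h h1 a hv, ?_⟩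
      · rw [← rho_simple cs]; exact roots_stable cs _ h
      · rwa [rho_mul, rho_simple] at h2

theorem main_fin (cs : CoxeterSystem M W)
    (hirr : (SimpleGraph.fromRel fun b b' : B => M b b' ≠ 2).Connected) (s : B)
    (hF : {v | v ∈ roots cs ∧ 0 < v s}.Finite) : Finite W := by
  set F := {v | v ∈ roots cs ∧ 0 < v s} with hFdef
  have hstabF : ∀ g, (∀ v, (rho cs g v) s = v s) → ∀ v ∈ F, rho cs g v ∈ F := by
    rintro g hg v ⟨h1, h2⟩
    exact ⟨roots_stable cs g h1, by rwa [hg]⟩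
  have hsimp : ∀ a, a ≠ s → ∀ v, (rho cs (cs.simple a) v) s = v s := by
    intro a ha v
    rw [rho_simple, rf_apply]
    simp [al, Finsupp.single_apply, ha]
  have hals : al s ∈ F := ⟨⟨1, s, by simp⟩, by rw [al_self]; norm_num⟩
  have hspan1 : ∀ t, al t ∈ Submodule.span ℝ F := by
    intro t
    have hreach := hirr.preconnected s t
    obtain ⟨p⟩ := hreach
    have hstep : ∀ u t, (SimpleGraph.fromRel fun b b' : B => M b b' ≠ 2).Adj u t →
        al u ∈ Submodule.span ℝ F → al t ∈ Submodule.span ℝ F := by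
      intro u t hadj hu
      by_cases hts : t = s
      · subst hts; exact Submodule.subset_span hals
      rw [SimpleGraph.fromRel_adj] at hadj
      have hM : M t u ≠ 2 := by
        rcases hadj.2 with h | h
        · rwa [M.symmetric]
        · exact h
      have hk := kc_ne_zero hadj.1.symm hM
      have h1 : rho cs (cs.simple t) (al u) ∈ Submodule.span ℝ F := by
        have hmap : (Submodule.span ℝ F) ≤ (Submodule.span ℝ F).comap
            (rho cs (cs.simple t)).toLinearMap := by
          rw [Submodule.span_le]
          intro v hv
          exact Submodule.subset_span (hstabF _ (hsimp t hts) v hv)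
        exact hmap hu
      rw [rho_simple, rf_apply, cr_al] at h1
      have h2 := Submodule.sub_mem _ hu h1
      rw [sub_sub_cancel] at h2
      exact (Submodule.smul_mem_iff _ hk).mp h2
    have : ∀ {u t} (p : (SimpleGraph.fromRel fun b b' : B => M b b' ≠ 2).Walk u t),
        al u ∈ Submodule.span ℝ F → al t ∈ Submodule.span ℝ F := by
      intro u t p
      induction p with
      | nil => exact id
      | cons h p ih => intro hu; exact ih (hstep _ _ h hu)
    exact this p (Submodule.subset_span hals)
  have hspan : Submodule.span ℝ F = ⊤ := by
    rw [eq_top_iff]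
    rintro v -
    induction v using Finsupp.induction_linear with
    | zero => exact Submodule.zero_mem _
    | add f g hf hg => exact Submodule.add_mem _ hf hg
    | single b r =>
      have : Finsupp.single b r = r • (al b : B →₀ ℝ) := by simp [al]
      rw [this]
      exact Submodule.smul_mem _ _ (hspan1 b)
  have hfinV : Module.Finite ℝ (B →₀ ℝ) := ⟨⟨hF.toFinset, by simpa using hspan⟩⟩
  have hB : Finite B := Module.Finite.finite_basis (Finsupp.basisSingleOne (R := ℝ) (ι := B))
  have hFf : Finite F := hF
  -- the stabilizer is finite
  let St : Set W := {g | ∀ v, (rho cs g v) s = v s}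
  have hSt : St.Finite := by
    let Θ : St → (F → F) := fun g v => ⟨rho cs g.1 v.1, hstabF g.1 g.2 v.1 v.2⟩
    have hΘ : Function.Injective Θ := by
      rintro g g' hgg
      have h1 : ∀ v ∈ F, rho cs g.1 v = rho cs g'.1 v := by
        intro v hv
        exact congrArg Subtype.val (congrFun hgg ⟨v, hv⟩)
      have h2 : (rho cs g.1).toLinearMap = (rho cs g'.1).toLinearMap :=
        LinearMap.ext_on hspan h1
      have h3 : g'.1⁻¹ * g.1 = 1 := by
        apply faithful cs
        intro v
        have : rho cs g.1 v = rho cs g'.1 v := LinearMap.congr_fun h2 v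
        rw [rho_mul, this, ← rho_mul, inv_mul_cancel, map_one]
        rfl
      exact Subtype.ext (inv_mul_eq_one.mp h3).symm
    exact Finite.of_injective Θ hΘ
  let A : Set ℝ := ((fun v : B →₀ ℝ => v s) '' F ∪ (fun v : B →₀ ℝ => - v s) '' F) ∪ {0}
  have hA : A.Finite := ((hF.image _).union (hF.image _)).union (Set.finite_singleton 0)
  let Ψ : W → (B → ℝ) := fun w t => (rho cs w (al t)) s
  have hΨA : ∀ w, Ψ w ∈ Set.pi Set.univ (fun _ : B => A) := by
    intro w t _
    have hr : rho cs w (al t) ∈ roots cs := ⟨w, t, rfl⟩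
    rcases lt_trichotomy ((rho cs w (al t)) s) 0 with h | h | h
    · refine Or.inl (Or.inr ⟨- rho cs w (al t), ⟨root_neg cs hr, ?_⟩, ?_⟩)
      · simpa using h
      · simp [Ψ]
    · exact Or.inr h
    · exact Or.inl (Or.inl ⟨_, ⟨hr, h⟩, rfl⟩)
  have hfib : ∀ w, {w' | Ψ w' = Ψ w}.Finite := by
    intro w
    apply (hSt.image (fun g => g * w)).subset
    intro w' hw'
    refine ⟨w' * w⁻¹, ?_, by simp⟩
    have hall : ∀ v, (rho cs w' v) s = (rho cs w v) s := by
      intro v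
      induction v using Finsupp.induction_linear with
      | zero => simp
      | add f g hf hg => simp [hf, hg]
      | single b r =>
        have : Finsupp.single b r = r • (al b : B →₀ ℝ) := by simp [al]
        have h2 : (rho cs w' (al b)) s = (rho cs w (al b)) s := congrFun hw' b
        rw [this, map_smul, map_smul, Finsupp.smul_apply, Finsupp.smul_apply, h2]
    intro v
    rw [rho_mul, hall, ← rho_mul, mul_inv_cancel, map_one]
    rfl
  have hpi : (Set.pi Set.univ (fun _ : B => A)).Finite := Set.Finite.pi' (fun _ => hA) |>.subset
    (by intro f hf t; exact hf t trivial)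
  rw [← Set.finite_univ_iff]
  refine Set.Finite.of_finite_fibers Ψ (hpi.subset ?_) ?_
  · rintro _ ⟨w, -, rfl⟩; exact hΨA w
  · rintro _ ⟨w, -, rfl⟩
    exact (hfib w).subset (fun w' h => h.2)

theorem main (cs : CoxeterSystem M W)
    (hirr : (SimpleGraph.fromRel fun b b' : B => M b b' ≠ 2).Connected)
    (hinf : Infinite W) (s : B) (w : W)
    (hw : ∀ x ∈ Subgroup.closure (cs.simple '' {s}ᶜ),
      w * x * w⁻¹ ∈ Subgroup.closure (cs.simple '' {s}ᶜ)) :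
    w ∈ Subgroup.closure (cs.simple '' {s}ᶜ) := by
  set H := Subgroup.closure (cs.simple '' {s}ᶜ) with hH
  have hHs : ∀ a, a ≠ s → cs.simple a ∈ H := fun a ha => Subgroup.subset_closure ⟨a, ha, rfl⟩
  obtain ⟨h, hmin⟩ : ∃ h : H, ∀ h' : H, cs.length (w * h.1) ≤ cs.length (w * h'.1) := by
    have := Function.argmin_le (fun h : H => cs.length (w * h.1))
    exact ⟨_, fun h' => this h'⟩
  obtain ⟨h, hh⟩ := h
  set d := w * h with hd
  have hdmin : ∀ a, a ≠ s → ¬ cs.IsRightDescent d a := by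
    intro a ha hdes
    have := hmin ⟨h * cs.simple a, H.mul_mem hh (hHs a ha)⟩
    simp only [← mul_assoc, ← hd] at this
    unfold CoxeterSystem.IsRightDescent at hdes
    omega
  have hdn : ∀ x ∈ H, d * x * d⁻¹ ∈ H := by
    intro x hx
    have := hw (h * x * h⁻¹) (H.mul_mem (H.mul_mem hh hx) (H.inv_mem hh))
    have e : d * x * d⁻¹ = w * (h * x * h⁻¹) * w⁻¹ := by rw [hd]; group
    rwa [e]
  by_cases hd1 : d = 1
  · have : w = h⁻¹ := eq_inv_of_mul_eq_one_left hd1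
    rw [this]; exact H.inv_mem hh
  exfalso
  have hHf : ∀ g ∈ H, ∀ v, (rho cs g v) s = v s := by
    intro g hg
    induction hg using Subgroup.closure_induction with
    | mem x hx =>
      obtain ⟨a, ha, rfl⟩ := hx
      intro v
      have ha : a ≠ s := ha
      rw [rho_simple, rf_apply]
      simp [al, Finsupp.single_apply, ha]
    | one => simp
    | mul x y _ _ hx hy => intro v; rw [rho_mul, hx, hy]
    | inv x _ hx =>
      intro v
      rw [← hx (rho cs x⁻¹ v), ← rho_mul, mul_inv_cancel, map_one]
      rfl
  have hzero : ∀ a, a ≠ s → (rho cs d (al a)) s = 0 := by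
    intro a ha
    have h1 := hHf _ (hdn _ (hHs a ha)) (rho cs d (al a))
    rw [← rho_mul, inv_mul_cancel_right, rho_mul, rho_simple_al, map_neg] at h1
    simp only [Finsupp.coe_neg, Pi.neg_apply] at h1
    linarith
  set c := (rho cs d (al s)) s with hc
  have hscale : ∀ v, (rho cs d v) s = c * v s := by
    intro v
    induction v using Finsupp.induction_linear with
    | zero => simp
    | add f g hf hg => simp [hf, hg]; ring
    | single b r =>
      have : Finsupp.single b r = r • (al b : B →₀ ℝ) := by simp [al]
      rw [this, map_smul, Finsupp.smul_apply, Finsupp.smul_apply]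
      by_cases hb : b = s
      · subst hb; rw [← hc, al_self]; simp; ring
      · rw [hzero b hb]; simp [al, Finsupp.single_apply, hb]
  obtain ⟨r, hr⟩ := cs.exists_rightDescent_of_ne_one hd1
  have hrs : r = s := by
    by_contra hne
    exact hdmin r hne hr
  subst hrs
  have hc0 : c ≤ 0 := neg_of_descent cs d r hr r
  have hcne : c ≠ 0 := by
    intro h0
    have h1 := hscale (rho cs d⁻¹ (al r))
    rw [← rho_mul, mul_inv_cancel, map_one, h0, zero_mul] at h1
    have h2 : (al r : B →₀ ℝ) r = 0 := h1
    rw [al_self] at h2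
    norm_num at h2
  have hcneg : c < 0 := lt_of_le_of_ne hc0 hcne
  have hF : {v | v ∈ roots cs ∧ 0 < v r}.Finite := by
    apply (inv_finite cs d).subset
    rintro v ⟨h1, h2⟩
    refine ⟨h1, (root_sign cs h1).resolve_right ?_, 
      (root_sign cs (roots_stable cs d h1)).resolve_left ?_⟩
    · intro hle
      have : v r ≤ 0 := hle r
      linarith
    · intro hge
      have h3 : 0 ≤ (rho cs d v) r := hge r
      rw [hscale] at h3
      nlinarith
  have := main_fin cs hirr r hF
  exact not_finite W

end CoxGeom


/-- Let `(W,S)` be an irreducible Coxeter system (connected Coxeter graph: distinct `s, t` are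
adjacent iff `m(s,t) ≠ 2`, where `m(s,t) = 0` encodes `∞`) with `W` infinite, and let
`I = S \ {s}`.  Then any element of `W` normalizing the standard parabolic subgroup `W_I`
belongs to `W_I`. -/
theorem stmt_4 {B W : Type*} [Group W] {M : CoxeterMatrix B} (cs : CoxeterSystem M W)
    (hirr : (SimpleGraph.fromRel fun b b' : B => M b b' ≠ 2).Connected)
    (hinf : Infinite W) (s : B) (w : W)
    (hw : (Subgroup.closure (cs.simple '' {s}ᶜ)).map (MulAut.conj w).toMonoidHom
        = Subgroup.closure (cs.simple '' {s}ᶜ)) :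
    w ∈ Subgroup.closure (cs.simple '' {s}ᶜ) := by
  apply CoxGeom.main cs hirr hinf s w
  intro x hx
  rw [← hw]
  exact ⟨x, hx, by simp⟩
end

section
/- (Brink) Let (W,S) be a Coxeter system and let y_0, y_1, …, y_n ∈ S (n ≥ 1) be a non-backtracking path in the odd Coxeter graph of (W,S): for each 0 ≤ i ≤ n−1, y_i ≠ y_{i+1} and m_i := m(y_i, y_{i+1}) is finite and odd, and y_{i+2} ≠ y_i for 0 ≤ i ≤ n−2. Put w_i = (y_{i+1} y_i)^{(m_i − 1)/2} for 0 ≤ i ≤ n−1. Then ℓ(w_0 w_1 ⋯ w_{n−1}) = Σ_{i=0}^{n−1} ℓ(w_i). -/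
namespace Brink

/-- Chebyshev-type sequence. -/
def U (κ : ℝ) : ℕ → ℝ
  | 0 => 0
  | 1 => 1
  | (n+2) => κ * U κ (n+1) - U κ n

lemma U_add_two (κ : ℝ) (n : ℕ) : U κ (n+2) = κ * U κ (n+1) - U κ n := rfl

lemma U_two_eq (n : ℕ) : U 2 n = n ∧ U 2 (n+1) = n + 1 := by
  induction n with
  | zero => simp [U]
  | succ n ih =>
    refine ⟨by rw [ih.2]; push_cast; ring, ?_⟩
    rw [U_add_two, ih.1, ih.2]; push_cast; ring

lemma sin_mul_U (θ : ℝ) (n : ℕ) :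
    Real.sin θ * U (2 * Real.cos θ) n = Real.sin (n * θ) ∧
    Real.sin θ * U (2 * Real.cos θ) (n+1) = Real.sin ((n+1) * θ) := by
  induction n with
  | zero => simp [U]
  | succ n ih =>
    refine ⟨by rw [ih.2]; push_cast; ring_nf, ?_⟩
    have h : Real.sin ((n + 1) * θ + θ) + Real.sin ((n + 1) * θ - θ)
        = 2 * Real.cos θ * Real.sin ((n + 1) * θ) := by
      rw [Real.sin_add, Real.sin_sub]; ring
    have e1 : ((n:ℝ) + 1) * θ - θ = n * θ := by ring
    have e2 : (((n + 1 : ℕ) : ℝ) + 1) * θ = (n + 1) * θ + θ := by push_cast; ring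
    rw [e1] at h
    rw [U_add_two, e2]
    linear_combination -h + 2 * Real.cos θ * ih.2 - ih.1

/-- the Coxeter cosine -/
noncomputable def K (m : ℕ) : ℝ := 2 * Real.cos (Real.pi / m)

lemma K_zero : K 0 = 2 := by simp [K]
lemma K_one : K 1 = -2 := by simp [K]

lemma sin_pos' {m : ℕ} (hm : 2 ≤ m) : 0 < Real.sin (Real.pi / m) := by
  have h2 : (2:ℝ) ≤ m := by exact_mod_cast hm
  apply Real.sin_pos_of_pos_of_lt_pi
  · have := Real.pi_pos; positivity
  · rw [div_lt_iff₀ (by linarith)]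
    nlinarith [Real.pi_pos]

lemma K_nonneg {m : ℕ} (hm : m ≠ 1) : 0 ≤ K m := by
  rcases Nat.eq_zero_or_pos m with rfl | h
  · simp [K_zero]
  have h2 : (2:ℝ) ≤ m := by exact_mod_cast (by omega : 2 ≤ m)
  have : Real.pi / m ≤ Real.pi / 2 := by gcongr
  have h0 : 0 ≤ Real.pi / m := by have := Real.pi_pos; positivity
  have := Real.cos_nonneg_of_mem_Icc ⟨by linarith [Real.pi_pos], this⟩
  unfold K; linarith

lemma K_ge_one {m : ℕ} (hm : 3 ≤ m) : 1 ≤ K m := by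
  have h2 : (3:ℝ) ≤ m := by exact_mod_cast hm
  have h1 : Real.pi / m ≤ Real.pi / 3 := by gcongr
  have h0 : 0 ≤ Real.pi / m := by have := Real.pi_pos; positivity
  have := Real.cos_le_cos_of_nonneg_of_le_pi h0 (by linarith [Real.pi_pos]) h1
  rw [Real.cos_pi_div_three] at this
  unfold K; linarith

lemma U_nonneg {m n : ℕ} (hm : m ≠ 1) (h : m = 0 ∨ n ≤ m) : 0 ≤ U (K m) n := by
  rcases Nat.eq_zero_or_pos m with rfl | h0
  · rw [K_zero, (U_two_eq n).1]; positivity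
  have hnm : n ≤ m := by omega
  have hs := sin_pos' (m := m) (by omega)
  have := (sin_mul_U (Real.pi / m) n).1
  have h3 : 0 ≤ Real.sin (n * (Real.pi / m)) := by
    apply Real.sin_nonneg_of_nonneg_of_le_pi
    · have := Real.pi_pos; positivity
    · have hm' : (0:ℝ) < m := by exact_mod_cast h0
      rw [← mul_div_assoc, div_le_iff₀ hm', mul_comm]
      have : (n:ℝ) ≤ m := by exact_mod_cast hnm
      have := Real.pi_pos
      gcongr
  rw [← this] at h3
  exact nonneg_of_mul_nonneg_right h3 hs

lemma U_self {m : ℕ} (hm : 2 ≤ m) : U (K m) m = 0 := by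
  have hs := sin_pos' hm
  have h := (sin_mul_U (Real.pi / m) m).1
  have hm' : (m:ℝ) ≠ 0 := by exact_mod_cast (by omega : m ≠ 0)
  rw [mul_div_cancel₀ _ hm', Real.sin_pi] at h
  exact (mul_eq_zero.1 h).resolve_left hs.ne'

lemma U_self_sub {m n : ℕ} (hm : 2 ≤ m) (hn : n + 1 = m) : U (K m) n = 1 := by
  have hs := sin_pos' hm
  have h := (sin_mul_U (Real.pi / m) n).1
  have hm' : (m:ℝ) ≠ 0 := by exact_mod_cast (by omega : m ≠ 0)
  have e : (n:ℝ) * (Real.pi / m) = Real.pi - Real.pi / m := by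
    have : (n:ℝ) = m - 1 := by rw [← hn]; simp
    rw [this]; field_simp
  rw [e, Real.sin_pi_sub] at h
  exact mul_left_cancel₀ hs.ne' (by rw [mul_one]; exact h)

lemma U_two_self {m : ℕ} (hm : 2 ≤ m) : U (K m) (2 * m) = 0 ∧ U (K m) (2 * m + 1) = 1 := by
  have hs := sin_pos' hm
  obtain ⟨h, h'⟩ := (sin_mul_U (Real.pi / m) (2 * m))
  have hm' : (m:ℝ) ≠ 0 := by exact_mod_cast (by omega : m ≠ 0)
  have e : ((2 * m : ℕ):ℝ) * (Real.pi / m) = 2 * Real.pi := by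
    push_cast; field_simp
  have e' : (((2 * m : ℕ):ℝ) + 1) * (Real.pi / m) = Real.pi / m + 2 * Real.pi := by
    push_cast; field_simp; ring
  rw [e, Real.sin_two_pi] at h
  rw [e', Real.sin_add_two_pi] at h'
  exact ⟨(mul_eq_zero.1 h).resolve_left hs.ne',
    mul_left_cancel₀ hs.ne' (by rw [mul_one]; exact h')⟩

section rep
variable {B : Type*} (M : CoxeterMatrix B)

/-- simple root -/
noncomputable def rt (s : B) : B →₀ ℝ := Finsupp.single s 1

/-- functional -/
noncomputable def phi (s : B) : (B →₀ ℝ) →ₗ[ℝ] ℝ :=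
  Finsupp.linearCombination ℝ (fun t => K (M s t))

/-- simple reflection -/
noncomputable def sig (s : B) : Module.End ℝ (B →₀ ℝ) :=
  LinearMap.id + (phi M s).smulRight (rt s)

lemma phi_rt (s t : B) : phi M s (rt t) = K (M s t) := by simp [phi, rt]

lemma sig_apply (s : B) (v : B →₀ ℝ) : sig M s v = v + phi M s v • rt s := by simp [sig]

lemma sig_rt (s t : B) : sig M s (rt t) = rt t + K (M s t) • rt s := by
  rw [sig_apply, phi_rt]

lemma sig_self (s : B) : sig M s (rt s) = - rt s := by
  rw [sig_rt, M.diagonal, K_one]; module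

lemma sig_sig (s : B) : sig M s * sig M s = 1 := by
  ext1 t
  ext1
  change sig M s (sig M s (rt t)) = rt t
  rw [sig_rt, map_add, map_smul, sig_self, sig_rt]
  module

lemma pow_rt (s t : B) (n : ℕ) :
    ((sig M s * sig M t) ^ n) (rt s)
      = U (K (M s t)) (2 * n + 1) • rt s + U (K (M s t)) (2 * n) • rt t ∧
    ((sig M s * sig M t) ^ n) (rt t)
      = (-U (K (M s t)) (2 * n)) • rt s
        + (U (K (M s t)) (2 * n + 1) - K (M s t) * U (K (M s t)) (2 * n)) • rt t := by
  induction n with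
  | zero => simp [U]
  | succ n ih =>
    have e3 : U (K (M s t)) (2 * (n+1) + 1) = K (M s t) *
      (K (M s t) * U (K (M s t)) (2 * n + 1) - U (K (M s t)) (2 * n))
        - U (K (M s t)) (2 * n + 1) := rfl
    have e2 : U (K (M s t)) (2 * (n+1)) =
      (K (M s t) * U (K (M s t)) (2 * n + 1) - U (K (M s t)) (2 * n)) := rfl
    have hts : K (M t s) = K (M s t) := by rw [M.symmetric]
    have hss : K (M s s) = -2 := by rw [M.diagonal, K_one]
    have htt : K (M t t) = -2 := by rw [M.diagonal, K_one]
    rw [pow_succ', Module.End.mul_apply, Module.End.mul_apply _ _ (rt t), ih.1, ih.2, e3, e2]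
    simp only [map_add, map_smul, Module.End.mul_apply, sig_rt, hts, hss, htt]
    constructor <;> module

lemma liftable : M.IsLiftable (sig M) := by
  intro s t
  by_cases hst : s = t
  · subst hst; rw [sig_sig, one_pow]
  rcases Nat.eq_zero_or_pos (M s t) with h0 | h0
  · rw [h0, pow_zero]
  have hm1 : M s t ≠ 1 := M.off_diagonal s t hst
  have hm : 2 ≤ M s t := by omega
  set m := M s t with hmd
  have hts : M t s = m := by rw [M.symmetric]
  have hr1 := (pow_rt M s t m).1
  have hr2 := (pow_rt M s t m).2
  obtain ⟨u1, u2⟩ := U_two_self hm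
  rw [← hmd, u1, u2] at hr1 hr2
  have hr1' : ((sig M s * sig M t) ^ m) (rt s) = rt s := by rw [hr1]; module
  have hr2' : ((sig M s * sig M t) ^ m) (rt t) = rt t := by rw [hr2]; module
  have hdet : 4 - K m ^ 2 ≠ 0 := by
    have := sin_pos' hm
    have h2 := Real.sin_sq_add_cos_sq (Real.pi / m)
    unfold K
    nlinarith
  refine LinearMap.ext fun v => ?_
  rw [Module.End.one_apply]
  -- decompose
  obtain ⟨a, b, h1, h2⟩ : ∃ a b : ℝ, phi M s (v + a • rt s + b • rt t) = 0 ∧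
      phi M t (v + a • rt s + b • rt t) = 0 := by
    refine ⟨(2 * phi M s v + K m * phi M t v) / (4 - K m ^ 2),
      (2 * phi M t v + K m * phi M s v) / (4 - K m ^ 2), ?_, ?_⟩ <;>
    · simp only [map_add, map_smul, phi_rt, M.diagonal, K_one, hts, ← hmd, smul_eq_mul]
      field_simp
      ring
  set v' := v + a • rt s + b • rt t with hv'
  have hfix : ∀ n : ℕ, ((sig M s * sig M t) ^ n) v' = v' := by
    intro n
    induction n with
    | zero => simp
    | succ n ih =>
      rw [pow_succ', Module.End.mul_apply, ih, Module.End.mul_apply, sig_apply, sig_apply, h2]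
      simp [h1]
  have hv : v = v' - a • rt s - b • rt t := by rw [hv']; module
  rw [hv, map_sub, map_sub, map_smul, map_smul, hr1', hr2', hfix]

end rep

section len
variable {B W : Type*} [Group W] {M : CoxeterMatrix B} (cs : CoxeterSystem M W)

/-- geometric representation -/
noncomputable def rho : W →* Module.End ℝ (B →₀ ℝ) := cs.lift ⟨sig M, liftable M⟩

lemma rho_simple (s : B) : rho cs (cs.simple s) = sig M s := cs.lift_apply_simple (liftable M) s

lemma rho_mul (v w : W) (x : B →₀ ℝ) : rho cs (v * w) x = rho cs v (rho cs w x) := by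
  rw [map_mul, Module.End.mul_apply]

open CoxeterSystem in
lemma rho_alt (s t : B) (n : ℕ) :
    rho cs (cs.wordProd (alternatingWord s t n)) (rt s)
      = U (K (M s t)) (n + 1) • rt (if Even n then s else t)
        + U (K (M s t)) n • rt (if Even n then t else s) := by
  induction n with
  | zero => simp [alternatingWord, U]
  | succ n ih =>
    have hts : K (M t s) = K (M s t) := by rw [M.symmetric]
    have hss : K (M s s) = -2 := by rw [M.diagonal, K_one]
    have htt : K (M t t) = -2 := by rw [M.diagonal, K_one]
    rw [alternatingWord_succ', cs.wordProd_cons, rho_mul, ih, rho_simple, U_add_two]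
    by_cases h : Even n
    · have : ¬ Even (n+1) := by rw [Nat.even_add_one]; simpa using h
      simp only [h, this, if_true, if_false, map_add, map_smul, sig_rt, htt, hts]
      module
    · have : Even (n+1) := by rw [Nat.even_add_one]; exact h
      simp only [h, this, if_true, if_false, map_add, map_smul, sig_rt, hss]
      module

/-- nonnegative coefficients -/
def NN (v : B →₀ ℝ) : Prop := ∀ b, 0 ≤ v b

lemma NN.add {v w : B →₀ ℝ} (hv : NN v) (hw : NN w) : NN (v + w) := fun b =>
  add_nonneg (hv b) (hw b)
lemma NN.smul {v : B →₀ ℝ} {c : ℝ} (hc : 0 ≤ c) (hv : NN v) : NN (c • v) := fun b =>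
  mul_nonneg hc (hv b)
lemma NN_rt (s : B) : NN (rt s) := fun b => by
  classical
  rw [rt, Finsupp.single_apply]; split_ifs <;> norm_num

open CoxeterSystem in
lemma alt_pos {s t : B} (hst : s ≠ t) {n : ℕ} (hn : M s t = 0 ∨ n < M s t) (v : W)
    (hs : NN (rho cs v (rt s))) (ht : NN (rho cs v (rt t))) :
    NN (rho cs (v * cs.wordProd (alternatingWord s t n)) (rt s)) := by
  have hm1 : M s t ≠ 1 := M.off_diagonal s t hst
  rw [rho_mul, rho_alt, map_add, map_smul, map_smul]
  refine NN.add (NN.smul (U_nonneg hm1 (by omega)) ?_) (NN.smul (U_nonneg hm1 (by omega)) ?_)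
  all_goals split_ifs <;> assumption

open CoxeterSystem in
lemma alt_append {B : Type*} (s t : B) (m j : ℕ) : ∃ ω : List B, ω.length = j ∧
    alternatingWord s t (j + m) = ω ++ alternatingWord s t m := by
  induction j with
  | zero => exact ⟨[], rfl, by simp⟩
  | succ j ih =>
    obtain ⟨ω, h1, h2⟩ := ih
    refine ⟨(if Even (j + m) then t else s) :: ω, by simp [h1], ?_⟩
    rw [show j + 1 + m = j + m + 1 by ring, alternatingWord_succ', h2]
    rfl

open CoxeterSystem in
theorem nn_of_lt (N : ℕ) : ∀ w : W, cs.length w = N → ∀ s : B,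
    cs.length w < cs.length (w * cs.simple s) → NN (rho cs w (rt s)) := by
  induction N using Nat.strong_induction_on with
  | _ N IH =>
  intro w hw s hs
  by_cases hw1 : w = 1
  · subst hw1; simpa using NN_rt s
  obtain ⟨t, ht⟩ := cs.exists_rightDescent_of_ne_one hw1
  have hst : s ≠ t := by
    rintro rfl
    unfold IsRightDescent at ht; omega
  -- inner claim
  have key : ∀ L : ℕ, ∀ v : W, cs.length v = L → ∀ k : ℕ, 1 ≤ k →
      w = v * cs.wordProd (alternatingWord s t k) → cs.length w = cs.length v + k →
      NN (rho cs w (rt s)) := by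
    intro L
    induction L using Nat.strong_induction_on with
    | _ L ihL =>
    intro v hv k hk hwv hlen
    obtain ⟨k, rfl⟩ : ∃ k', k = k' + 1 := ⟨k - 1, by omega⟩
    by_cases hg : cs.length (v * cs.simple (if Even (k+1) then t else s)) < cs.length v
    · have := cs.isRightDescent_iff.1 hg
      refine ihL (cs.length (v * cs.simple (if Even (k+1) then t else s))) (by omega) _ rfl
        (k + 1 + 1) (by omega) ?_ (by omega)
      rw [alternatingWord_succ', cs.wordProd_cons, mul_assoc, cs.simple_mul_simple_cancel_left]
      exact hwv
    have hf : ¬ cs.length (v * cs.simple (if Even k then t else s)) < cs.length v := by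
      intro hf
      have h1 := cs.isRightDescent_iff.1 hf
      rw [alternatingWord_succ', cs.wordProd_cons, ← mul_assoc] at hwv
      have h2 := cs.length_mul_le (v * cs.simple (if Even k then t else s))
        (cs.wordProd (alternatingWord s t k))
      have h3 := cs.length_wordProd_le (alternatingWord s t k)
      rw [length_alternatingWord] at h3
      rw [← hwv] at h2
      omega
    have hg' := IH (cs.length v) (by omega) v rfl (if Even (k+1) then t else s)
      (by have := cs.not_isRightDescent_iff.1 hg; omega)
    have hf' := IH (cs.length v) (by omega) v rfl (if Even k then t else s)
      (by have := cs.not_isRightDescent_iff.1 hf; omega)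
    have hboth : NN (rho cs v (rt s)) ∧ NN (rho cs v (rt t)) := by
      by_cases h : Even k
      · have h' : ¬ Even (k+1) := by rw [Nat.even_add_one]; simpa using h
        simp only [h, h', if_true, if_false] at hg' hf'
        exact ⟨hg', hf'⟩
      · have h' : Even (k+1) := by rw [Nat.even_add_one]; exact h
        simp only [h, h', if_true, if_false] at hg' hf'
        exact ⟨hf', hg'⟩
    rw [hwv]
    refine alt_pos cs hst ?_ v hboth.1 hboth.2
    by_contra hcon
    push Not at hcon
    obtain ⟨h0, hle⟩ := hcon
    obtain ⟨j, hj⟩ : ∃ j, k + 1 = j + M s t := ⟨k + 1 - M s t, by omega⟩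
    obtain ⟨ω, hω, hω2⟩ := alt_append s t (M s t) j
    obtain ⟨m, hm⟩ : ∃ m, M s t = m + 1 := ⟨M s t - 1, by omega⟩
    have hbr : cs.wordProd (alternatingWord s t (M s t))
        = cs.wordProd (alternatingWord s t m) * cs.simple s := by
      have := cs.wordProd_braidWord_eq s t
      unfold braidWord at this
      rw [this, M.symmetric t s, hm, alternatingWord_succ, cs.wordProd_concat]
    have hws : w * cs.simple s = v * (cs.wordProd ω * cs.wordProd (alternatingWord s t m)) := by
      rw [hwv, hj, hω2, cs.wordProd_append, hbr]
      simp only [mul_assoc, cs.simple_mul_simple_self, mul_one]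
    have l1 := cs.length_mul_le v (cs.wordProd ω * cs.wordProd (alternatingWord s t m))
    have l2 := cs.length_mul_le (cs.wordProd ω) (cs.wordProd (alternatingWord s t m))
    have l3 := cs.length_wordProd_le ω
    have l4 := cs.length_wordProd_le (alternatingWord s t m)
    rw [length_alternatingWord] at l4
    rw [← hws] at l1
    omega
  refine key _ (w * cs.simple t) rfl 1 le_rfl (by simp [alternatingWord]) ?_
  have := cs.isRightDescent_iff.1 ht
  omega

theorem lt_of_nn (w : W) (s : B) (h : NN (rho cs w (rt s))) :
    cs.length (w * cs.simple s) = cs.length w + 1 := by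
  rcases cs.length_mul_simple w s with h' | h'
  · exact h'
  exfalso
  have h2 := nn_of_lt cs _ (w * cs.simple s) rfl s (by simp; omega)
  rw [rho_mul, rho_simple, sig_self, map_neg] at h2
  have h0 : rho cs w (rt s) = 0 := by
    ext b
    have := h b
    have := h2 b
    simp at this ⊢
    linarith
  have : rho cs w⁻¹ (rho cs w (rt s)) = rt s := by rw [← rho_mul]; simp
  rw [h0, map_zero] at this
  have := DFunLike.congr_fun this s
  simp [rt] at this

open CoxeterSystem in
lemma length_mul_alt (n : ℕ) : ∀ {s t : B}, s ≠ t → n ≤ M s t → ∀ v : W,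
    NN (rho cs v (rt s)) → NN (rho cs v (rt t)) →
    cs.length (v * cs.wordProd (alternatingWord s t n)) = cs.length v + n := by
  induction n with
  | zero => intro s t _ _ v _ _; simp [alternatingWord]
  | succ n ih =>
    intro s t hst hn v hs ht
    rw [alternatingWord_succ, cs.wordProd_concat, ← mul_assoc]
    have hts : M t s = M s t := M.symmetric t s
    rw [lt_of_nn cs _ t (alt_pos cs hst.symm (by omega) v ht hs),
      ih hst.symm (by omega) v ht hs]
    ring

open CoxeterSystem in
lemma length_mul_pow {b c : B} (hbc : b ≠ c) (k : ℕ) (hk : 2 * k ≤ M b c) (v : W)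
    (hb : NN (rho cs v (rt b))) (hc : NN (rho cs v (rt c))) :
    cs.length (v * (cs.simple c * cs.simple b) ^ k) = cs.length v + 2 * k := by
  rw [← length_mul_alt cs (2 * k) hbc.symm (by rwa [M.symmetric]) v hc hb,
    cs.prod_alternatingWord_eq_mul_pow]
  simp

lemma pow_third {b c s : B} (hbc : b ≠ c) (hsb : s ≠ b) (hsc : s ≠ c) (h3 : 3 ≤ M b c) (n : ℕ)
    (hn : 2 * (n + 1) < M b c) : ∃ x z : ℝ, K (M s b) ≤ x ∧ K (M s b) + K (M s c) ≤ z ∧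
      ((sig M c * sig M b) ^ (n + 1)) (rt s) = rt s + x • rt b + z • rt c := by
  have hcb : M c b = M b c := M.symmetric c b
  have hp : 0 ≤ K (M s b) := K_nonneg (M.off_diagonal _ _ hsb)
  have hq : 0 ≤ K (M s c) := K_nonneg (M.off_diagonal _ _ hsc)
  have hκ := K_ge_one h3
  have e : (sig M c * sig M b) (rt s) = rt s + K (M s b) • rt b
      + (K (M s c) + K (M b c) * K (M s b)) • rt c := by
    rw [Module.End.mul_apply, sig_rt, map_add, map_smul, sig_rt, sig_rt, hcb, M.symmetric c s,
      M.symmetric b s]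
    module
  induction n with
  | zero =>
    refine ⟨_, _, le_rfl, ?_, by rw [zero_add, pow_one, e]⟩
    nlinarith
  | succ n ih =>
    obtain ⟨x, z, hx, hz, h⟩ := ih (by omega)
    have hr := pow_rt M c b (n+1)
    rw [hcb] at hr
    have hm1 : M b c ≠ 1 := by omega
    have u1 : 0 ≤ U (K (M b c)) (2 * (n+1)) := U_nonneg hm1 (by omega)
    have u2 : 0 ≤ U (K (M b c)) (2 * (n+1) + 1) := U_nonneg hm1 (by omega)
    have u3 : 0 ≤ U (K (M b c)) (2 * (n+1) + 2) := U_nonneg hm1 (by omega)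
    rw [U_add_two] at u3
    refine ⟨x + (K (M s b) * U (K (M b c)) (2 * (n+1) + 1) + K (M s c) * U (K (M b c)) (2 * (n+1))),
      z + (K (M s b) * (K (M b c) * U (K (M b c)) (2 * (n+1) + 1) - U (K (M b c)) (2 * (n+1)))
        + K (M s c) * U (K (M b c)) (2 * (n+1) + 1)), ?_, ?_, ?_⟩
    · have := mul_nonneg hp u2
      have := mul_nonneg hq u1
      linarith
    · have := mul_nonneg hp u3
      have := mul_nonneg hq u2
      linarith
    · rw [pow_succ, Module.End.mul_apply, e, map_add, map_add, map_smul, map_smul, h, hr.1, hr.2]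
      module

/-- main induction -/
lemma main_step (y : ℕ → B) (n : ℕ)
    (hadj : ∀ i < n, y i ≠ y (i + 1) ∧ Odd (M (y i) (y (i + 1))))
    (hnb : ∀ i, i + 2 ≤ n → y (i + 2) ≠ y i)
    (w : ℕ → W)
    (hw : ∀ i < n,
      w i = (cs.simple (y (i + 1)) * cs.simple (y i)) ^ ((M (y i) (y (i + 1)) - 1) / 2))
    (v : ℕ → W) (hv0 : v 0 = 1) (hv : ∀ i, v (i+1) = v i * w i) :
    ∀ i ≤ n, rho cs (v i) (rt (y i)) = rt (y 0) ∧
      (∀ s, (∀ j, i = j + 1 → s ≠ y j) → NN (rho cs (v i) (rt s))) ∧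
      ∃ u : B →₀ ℝ, (∀ s, (∀ j, i = j + 1 → s ≠ y j) → 1 ≤ K (M s (y i)) →
        NN (rho cs (v i) (rt s) - u)) ∧
        ∀ j, i = j + 1 → rho cs (v i) (rt (y j)) = - u - K (M (y j) (y i)) • rt (y 0) := by
  intro i
  induction i with
  | zero =>
    intro _
    refine ⟨by simp [hv0], fun s _ => by simpa [hv0] using NN_rt s, 0, fun s _ _ => by
      simpa [hv0] using NN_rt s, fun j hj => by omega⟩
  | succ i ih =>
    intro hi
    obtain ⟨E, A, u, Bd, C⟩ := ih (by omega)
    obtain ⟨hbc, hodd⟩ := hadj i (by omega)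
    have hwi := hw i (by omega)
    have hvi := hv i
    have hm1 : M (y i) (y (i+1)) ≠ 1 := M.off_diagonal _ _ hbc
    have hcb : M (y (i+1)) (y i) = M (y i) (y (i+1)) := M.symmetric _ _
    obtain ⟨k, hk⟩ := hodd
    obtain ⟨k, rfl⟩ : ∃ k', k = k' + 1 := ⟨k - 1, by omega⟩
    have hk2 : (M (y i) (y (i + 1)) - 1) / 2 = k + 1 := by omega
    have hnbi : ∀ j, i = j + 1 → y (i+1) ≠ y j := by
      rintro j rfl; exact hnb j (by omega)
    have hrw : rho cs (w i) = (sig M (y (i+1)) * sig M (y i)) ^ (k+1) := by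
      rw [hwi, hk2, map_pow, map_mul, rho_simple, rho_simple]
    generalize y (i+1) = c at *
    have hr := pow_rt M c (y i) (k+1)
    rw [← hrw, hcb] at hr
    have t1 : U (K (M (y i) c)) (2 * (k+1) + 1) = 0 := by
      have := U_self (m := M (y i) c) (by omega)
      rwa [← hk]
    have t2 : U (K (M (y i) c)) (2 * (k+1)) = 1 := U_self_sub (by omega) (by omega)
    rw [t1, t2] at hr
    have hAc : NN (rho cs (v i) (rt c)) := A c hnbi
    have hE' : rho cs (v (i+1)) (rt c) = rt (y 0) := by
      rw [hvi, rho_mul, hr.1, ← E]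
      congr 1
      module
    have hstep : ∀ s, s ≠ y i → s ≠ c → NN (rho cs (v (i+1)) (rt s)) ∧
        (1 ≤ K (M s c) → NN (rho cs (v (i+1)) (rt s) - rho cs (v i) (rt c))) := by
      intro s hsb hsc
      have hp : 0 ≤ K (M s (y i)) := K_nonneg (M.off_diagonal _ _ hsb)
      have hq : 0 ≤ K (M s c) := K_nonneg (M.off_diagonal _ _ hsc)
      obtain ⟨x, z, hx, hz, hxz⟩ := pow_third (M := M) hbc hsb hsc (by omega) k (by omega)
      have hform : rho cs (v (i+1)) (rt s)
          = rho cs (v i) (rt s) + x • rt (y 0) + z • rho cs (v i) (rt c) := by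
        rw [hvi, rho_mul, hrw, hxz, map_add, map_add, map_smul, map_smul, E]
      rw [hform]
      have hR := NN_rt (y 0)
      by_cases hs : ∀ j, i = j + 1 → s ≠ y j
      · have hAs := A s hs
        constructor
        · exact (hAs.add (hR.smul (by linarith))).add (hAc.smul (by linarith))
        · intro h1
          have := (hAs.add (hR.smul (by linarith : 0 ≤ x))).add
            (hAc.smul (by linarith : 0 ≤ z - 1))
          convert this using 1
          module
      · push Not at hs
        obtain ⟨j, hj, rfl⟩ := hs
        rw [C j hj]
        have hadj' := hadj j (by omega)
        rw [← hj] at hadj'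
        have hM1 : M (y j) (y i) ≠ 1 := M.off_diagonal _ _ hadj'.1
        have hp1 : 1 ≤ K (M (y j) (y i)) := K_ge_one (by
          obtain ⟨l, hl⟩ := hadj'.2; omega)
        have hBc := Bd c hnbi (by rw [hcb]; exact K_ge_one (by omega))
        constructor
        · have := (hBc.add (hR.smul (by linarith : 0 ≤ x - K (M (y j) (y i))))).add
            (hAc.smul (by linarith : 0 ≤ z - 1))
          convert this using 1
          module
        · intro h1
          have := (hBc.add (hR.smul (by linarith : 0 ≤ x - K (M (y j) (y i))))).add
            (hAc.smul (by linarith : 0 ≤ z - 2))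
          convert this using 1
          module
    refine ⟨hE', ?_, rho cs (v i) (rt c), ?_, ?_⟩
    · intro s hs
      by_cases hsc : s = c
      · subst hsc; rw [hE']; exact NN_rt _
      · exact (hstep s (hs i rfl) hsc).1
    · intro s hs h1
      have hsc : s ≠ c := by
        rintro rfl
        rw [M.diagonal, K_one] at h1
        norm_num at h1
      exact (hstep s (hs i rfl) hsc).2 h1
    · intro j hj
      obtain rfl : i = j := by omega
      rw [hvi, rho_mul, hr.2, ← E, ← map_smul, ← map_neg, ← map_sub]
      congr 1
      module

end len
end Brink


/-- (Brink) Let `y 0, y 1, …, y n` (`n ≥ 1`) be a non-backtracking path in the odd Coxeter graph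
of `(W,S)` (consecutive vertices distinct with `m(y i, y (i+1))` finite and odd, and
`y (i+2) ≠ y i`).  Setting `w i = (y (i+1) * y i) ^ ((m i - 1)/2)`, the length of the product
`w 0 * w 1 * ⋯ * w (n-1)` equals the sum of the lengths of the `w i`. -/
theorem stmt_5 {B W : Type*} [Group W] {M : CoxeterMatrix B} (cs : CoxeterSystem M W)
    (n : ℕ) (hn : 1 ≤ n) (y : ℕ → B)
    (hadj : ∀ i < n, y i ≠ y (i + 1) ∧ Odd (M (y i) (y (i + 1))))
    (hnb : ∀ i, i + 2 ≤ n → y (i + 2) ≠ y i)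
    (w : ℕ → W)
    (hw : ∀ i < n,
      w i = (cs.simple (y (i + 1)) * cs.simple (y i)) ^ ((M (y i) (y (i + 1)) - 1) / 2)) :
    cs.length (List.ofFn fun i : Fin n => w i).prod = ∑ i : Fin n, cs.length (w i) := by
  set v : ℕ → W := fun i => ((List.range i).map w).prod with hvdef
  have hv0 : v 0 = 1 := by simp [hvdef]
  have hv : ∀ i, v (i+1) = v i * w i := by
    intro i; simp [hvdef, List.range_succ]
  have key := Brink.main_step cs y n hadj hnb w hw v hv0 hv
  have hlen : ∀ i < n, ∀ u : W, Brink.NN (Brink.rho cs u (Brink.rt (y i))) →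
      Brink.NN (Brink.rho cs u (Brink.rt (y (i+1)))) →
      cs.length (u * w i) = cs.length u + 2 * ((M (y i) (y (i + 1)) - 1) / 2) := by
    intro i hi u h1 h2
    rw [hw i hi]
    exact Brink.length_mul_pow cs (hadj i hi).1 _ (by omega) u h1 h2
  have hwl : ∀ i < n, cs.length (w i) = 2 * ((M (y i) (y (i + 1)) - 1) / 2) := by
    intro i hi
    have := hlen i hi 1 (by simpa using Brink.NN_rt _) (by simpa using Brink.NN_rt _)
    simpa using this
  have hmain : ∀ i ≤ n, cs.length (v i) = ∑ j ∈ Finset.range i, cs.length (w j) := by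
    intro i
    induction i with
    | zero => simp [hv0]
    | succ i ih =>
      intro hi
      obtain ⟨E, A, -⟩ := key i (by omega)
      rw [hv, hlen i (by omega) (v i) (by rw [E]; exact Brink.NN_rt _)
        (A _ (by rintro j rfl; exact hnb j (by omega))), ih (by omega), Finset.sum_range_succ,
        hwl i (by omega)]
  have e : (List.ofFn fun i : Fin n => w i) = (List.range n).map w := by
    rw [List.ofFn_eq_map, ← List.map_coe_finRange_eq_range, List.map_map]; rfl
  rw [e, ← Fin.sum_univ_eq_sum_range (fun j => cs.length (w j)) n |>.symm]
  exact hmain n le_rfl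
end

section
/- Let (W,S) be a Coxeter system and let y_0, y_1, …, y_n ∈ S with n ≥ 1 be a non-backtracking path in the odd Coxeter graph of (W,S): for each 0 ≤ i ≤ n−1, y_i ≠ y_{i+1} and m_i := m(y_i, y_{i+1}) is finite and odd, and y_{i+2} ≠ y_i for 0 ≤ i ≤ n−2. Put w_i = (y_{i+1} y_i)^{(m_i − 1)/2} and w = w_0 w_1 ⋯ w_{n−1}. Then supp(w) = {y_0, y_1, …, y_n}; that is, the set of letters occurring in any reduced word for w is exactly {y_0, …, y_n}. -/
open scoped Classical in
/-- Reduced words in involutions indexed by unordered pairs. -/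
abbrev OddPath.RW (B : Type*) := {l : List (Sym2 B) // l.IsChain (· ≠ ·)}

namespace OddPath

variable {B W : Type*} [Group W] {M : CoxeterMatrix B}

open scoped Classical in
/-- Toggle the first letter of a reduced word (diagonal pairs act trivially). -/
noncomputable def tog (e : Sym2 B) (x : RW B) : RW B :=
  if e.IsDiag then x
  else if h : x.1.head? = some e then ⟨x.1.tail, x.2.tail⟩
  else ⟨e :: x.1, by
    rcases x with ⟨_ | ⟨f, l⟩, hx⟩
    · simp
    · simp only [List.head?_cons, Option.some.injEq] at h
      exact List.isChain_cons_cons.2 ⟨fun h' => h h'.symm, hx⟩⟩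

lemma tog_diag (s : B) (x : RW B) : tog s(s, s) x = x := by
  simp [tog]

lemma tog_tog (e : Sym2 B) (x : RW B) : tog e (tog e x) = x := by
  by_cases hd : e.IsDiag
  · simp [tog, hd]
  rcases x with ⟨_ | ⟨f, l⟩, hx⟩
  · simp [tog, hd]
  · by_cases hf : f = e
    · subst hf
      have : l.head? ≠ some f := by
        cases l with
        | nil => simp
        | cons g l =>
          have := (List.isChain_cons_cons.1 hx).1
          simpa using this.symm
      simp [tog, hd, this]
    · simp [tog, hd, hf]

lemma tog_cons (e : Sym2 B) (he : ¬ e.IsDiag) (l : List (Sym2 B)) (hl : l.IsChain (· ≠ ·))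
    (hl' : (e :: l).IsChain (· ≠ ·)) : tog e ⟨l, hl⟩ = ⟨e :: l, hl'⟩ := by
  have : l.head? ≠ some e := by
    cases l with
    | nil => simp
    | cons g l =>
      have := (List.isChain_cons_cons.1 hl').1
      simpa using this.symm
  simp [tog, he, this]

lemma mem_tog (e f : Sym2 B) (x : RW B) (h : f ∈ (tog e x).1) : f = e ∨ f ∈ x.1 := by
  unfold tog at h
  split_ifs at h with h1 h2
  · exact Or.inr h
  · exact Or.inr (List.mem_of_mem_tail h)
  · simpa using h

section dihedral

variable {V : Type*} [AddCommGroup V] [Module ℝ V]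

lemma dihedral_pow (S T : V →ₗ[ℝ] V) (a b : V) (θ : ℝ)
    (hSa : S a = -a) (hSb : S b = b + (2 * Real.cos θ) • a)
    (hTb : T b = -b) (hTa : T a = a + (2 * Real.cos θ) • b) (k : ℕ) (x : ℝ) :
    ((T * S) ^ k) (Real.sin (x + θ) • a + Real.sin x • b) =
      Real.sin (x - 2 * k * θ + θ) • a + Real.sin (x - 2 * k * θ) • b := by
  induction k generalizing x with
  | zero => simp
  | succ k ih =>
    rw [pow_succ, Module.End.mul_apply]
    have : (T * S) (Real.sin (x + θ) • a + Real.sin x • b) =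
        Real.sin ((x - 2 * θ) + θ) • a + Real.sin (x - 2 * θ) • b := by
      simp only [Module.End.mul_apply, map_add, map_smul, hSa, hSb, hTb, hTa, map_neg]
      have e1 : Real.sin (x - 2 * θ + θ) = 2 * Real.cos θ * Real.sin x - Real.sin (x + θ) := by
        rw [show x - 2 * θ + θ = x - θ by ring, Real.sin_sub, Real.sin_add]; ring
      have e2 : Real.sin (x - 2 * θ) =
          2 * Real.cos θ * (2 * Real.cos θ * Real.sin x - Real.sin (x + θ)) - Real.sin x := by
        rw [← e1, show x - 2 * θ + θ = x - θ by ring, Real.sin_sub, Real.sin_sub, Real.sin_two_mul,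
          Real.cos_two_mul]; ring
      rw [e1, e2]
      module
    rw [this, ih]
    push_cast
    congr 3 <;> ring_nf

lemma dihedral_fix (S T : V →ₗ[ℝ] V) (a b : V) (m : ℕ) (hm : 2 ≤ m)
    (hSa : S a = -a) (hSb : S b = b + (2 * Real.cos (Real.pi / m)) • a)
    (hTb : T b = -b) (hTa : T a = a + (2 * Real.cos (Real.pi / m)) • b) :
    ((T * S) ^ m) a = a ∧ ((T * S) ^ m) b = b ∧
      ∀ l, m = 2 * l + 1 → ((T * S) ^ l) b = a := by
  have hm0 : (m : ℝ) ≠ 0 := by positivity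
  have hm1 : (2 : ℝ) ≤ m := by exact_mod_cast hm
  have hs : Real.sin (Real.pi / m) ≠ 0 := by
    apply ne_of_gt
    apply Real.sin_pos_of_pos_of_lt_pi (by positivity)
    exact div_lt_self Real.pi_pos (by linarith)
  have key := dihedral_pow S T a b (Real.pi / m) hSa hSb hTb hTa
  have inj : ∀ v w : V, Real.sin (Real.pi / m) • v = Real.sin (Real.pi / m) • w → v = w :=
    fun v w h => smul_right_injective V hs h
  have e : 2 * (m : ℝ) * (Real.pi / m) = 2 * Real.pi := by field_simp
  refine ⟨?_, ?_, ?_⟩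
  · apply inj
    have := key m 0
    rw [e] at this
    simpa [Real.sin_add, ← sub_eq_neg_add] using this
  · apply inj
    have := key m (-(Real.pi / m))
    rw [e] at this
    simpa [Real.sin_sub, sub_add_eq_add_sub] using this
  · intro l hl
    apply inj
    have := key l (-(Real.pi / m))
    have e2 : -(Real.pi / m) - 2 * (l : ℝ) * (Real.pi / m) = - Real.pi := by
      rw [hl]; push_cast; field_simp; ring
    rw [e2] at this
    simpa [Real.sin_add] using this

end dihedral

open scoped Classical in
/-- Coefficients of the generalized Cartan matrix. -/
noncomputable def coef (M : CoxeterMatrix B) (s t : B) : ℝ :=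
  if Odd (M s t) then 2 * Real.cos (Real.pi / M s t) else 0

lemma coef_symm (s t : B) : coef M s t = coef M t s := by
  unfold coef; rw [M.symmetric s t]

lemma coef_self (s : B) : coef M s s = -2 := by
  simp [coef]

/-- The space of the twisted geometric representation. -/
abbrev Sp (B : Type*) := (B × RW B) →₀ ℝ

/-- Basis vectors. -/
noncomputable abbrev bv (t : B) (x : RW B) : Sp B := Finsupp.single (t, x) 1

/-- The twisted reflections. -/
noncomputable def sig (M : CoxeterMatrix B) (s : B) : Sp B →ₗ[ℝ] Sp B :=
  Finsupp.linearCombination ℝ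
    (fun p : B × RW B => bv p.1 p.2 + coef M s p.1 • bv s (tog s(s, p.1) p.2))

lemma sig_bv (s t : B) (x : RW B) :
    sig M s (bv t x) = bv t x + coef M s t • bv s (tog s(s, t) x) := by
  simp [sig, bv]

lemma sig_self (s : B) (x : RW B) : sig M s (bv s x) = - bv s x := by
  rw [sig_bv, coef_self, tog_diag]; module

lemma end_ext (f g : Sp B →ₗ[ℝ] Sp B) (h : ∀ t x, f (bv t x) = g (bv t x)) : f = g := by
  apply Finsupp.lhom_ext'
  rintro ⟨t, x⟩
  apply LinearMap.ext_ring
  exact h t x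

lemma sig_sq (s : B) : sig M s * sig M s = 1 := by
  apply end_ext
  intro t x
  rw [Module.End.mul_apply, sig_bv, map_add, map_smul, sig_bv, sig_self, Module.End.one_apply]
  module

/-- The dihedral relations on the two relevant basis vectors. -/
lemma sig_dihedral (s t : B) (hst : s ≠ t) (ho : Odd (M s t)) (x : RW B) :
    ((sig M t * sig M s) ^ (M s t)) (bv s x) = bv s x ∧
    ((sig M t * sig M s) ^ (M s t)) (bv t (tog s(s, t) x)) = bv t (tog s(s, t) x) ∧
    ∀ l, M s t = 2 * l + 1 → ((sig M t * sig M s) ^ l) (bv t (tog s(s, t) x)) = bv s x := by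
  have h2 : 2 ≤ M s t := by
    have := M.off_diagonal s t hst
    rcases ho with ⟨k, hk⟩
    omega
  apply dihedral_fix _ _ _ _ _ h2
  · exact sig_self _ _
  · rw [sig_bv, tog_tog, coef, if_pos ho]
  · exact sig_self _ _
  · rw [sig_bv, coef_symm, coef, if_pos ho, Sym2.eq_swap]

lemma sig_liftable : M.IsLiftable (sig M) := by
  intro s t
  by_cases hst : s = t
  · subst hst
    rw [sig_sq, one_pow]
  by_cases ho : Odd (M s t)
  · have ho' : Odd (M t s) := by rwa [M.symmetric t s]
    have fixs : ∀ x, ((sig M s * sig M t) ^ (M s t)) (bv s x) = bv s x := by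
      intro x
      have := (sig_dihedral t s (Ne.symm hst) ho' (tog s(s, t) x)).2.1
      rwa [Sym2.eq_swap, tog_tog, M.symmetric t s] at this
    have fixt : ∀ x, ((sig M s * sig M t) ^ (M s t)) (bv t x) = bv t x := by
      intro x
      have := (sig_dihedral t s (Ne.symm hst) ho' x).1
      rwa [M.symmetric t s] at this
    have h2 : 2 ≤ M s t := by
      have := M.off_diagonal s t hst
      rcases ho with ⟨k, hk⟩
      omega
    have hm1 : (2 : ℝ) ≤ M s t := by exact_mod_cast h2
    have hs : Real.sin (Real.pi / M s t) ≠ 0 := by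
      apply ne_of_gt
      apply Real.sin_pos_of_pos_of_lt_pi (by positivity)
      exact div_lt_self Real.pi_pos (by linarith)
    have hk : 4 - coef M s t ^ 2 ≠ 0 := by
      rw [coef, if_pos ho]
      have : 4 - (2 * Real.cos (Real.pi / M s t)) ^ 2 = 4 * Real.sin (Real.pi / M s t) ^ 2 := by
        rw [Real.sin_sq]; ring
      rw [this]; positivity
    apply end_ext
    intro u x
    rw [Module.End.one_apply]
    generalize hk1 : coef M s u = k1
    generalize hk2 : coef M t u = k2
    generalize hkk : coef M s t = k at *
    have hkk' : coef M t s = k := by rw [coef_symm, hkk]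
    generalize hx1 : tog s(s, u) x = x1
    generalize hx2 : tog s(t, u) x = x2
    obtain ⟨f, hf⟩ : ∃ f, f = bv u x
        + ((2 * k1 / (4 - k ^ 2)) • bv s x1 + (k1 * k / (4 - k ^ 2)) • bv t (tog s(s, t) x1))
        + ((2 * k2 / (4 - k ^ 2)) • bv t x2 + (k2 * k / (4 - k ^ 2)) • bv s (tog s(s, t) x2)) :=
      ⟨_, rfl⟩
    have fS : sig M s f = f := by
      rw [hf]
      simp only [map_add, map_smul, sig_self]
      simp only [sig_bv, tog_tog, hk1, hx1, hkk]
      match_scalars <;> field_simp <;> ring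
    have fT : sig M t f = f := by
      rw [hf]
      simp only [map_add, map_smul, sig_self]
      simp only [sig_bv, tog_tog, hk2, hx2, hkk', Sym2.eq_swap (a := t) (b := s)]
      match_scalars <;> field_simp <;> ring
    have fm : ∀ n : ℕ, ((sig M s * sig M t) ^ n) f = f := by
      intro n
      induction n with
      | zero => simp
      | succ n ih => rw [pow_succ, Module.End.mul_apply, Module.End.mul_apply, fT, fS, ih]
    have hu : bv u x = f
        - ((2 * k1 / (4 - k ^ 2)) • bv s x1 + (k1 * k / (4 - k ^ 2)) • bv t (tog s(s, t) x1))
        - ((2 * k2 / (4 - k ^ 2)) • bv t x2 + (k2 * k / (4 - k ^ 2)) • bv s (tog s(s, t) x2)) := by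
      rw [hf]; abel
    rw [hu]
    simp only [map_sub, map_add, map_smul, fm, fixs, fixt]
  · have h0 : coef M s t = 0 := by rw [coef, if_neg ho]
    have h0' : coef M t s = 0 := by rw [coef_symm, h0]
    have hc : sig M s * sig M t = sig M t * sig M s := by
      apply end_ext
      intro u x
      simp only [Module.End.mul_apply, sig_bv, map_add, map_smul, h0, h0']
      module
    have hsq : (sig M s * sig M t) ^ 2 = 1 := by
      rw [pow_two]
      nth_rw 2 [hc]
      rw [mul_assoc, ← mul_assoc (sig M t), sig_sq, one_mul, sig_sq]
    obtain ⟨r, hr⟩ := Nat.not_odd_iff_even.1 ho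
    rw [hr, ← two_mul, pow_mul, hsq, one_pow]

/-- The twisted geometric representation. -/
noncomputable def rep (cs : CoxeterSystem M W) : W →* (Sp B →ₗ[ℝ] Sp B) :=
  cs.lift ⟨sig M, sig_liftable⟩

lemma rep_simple (cs : CoxeterSystem M W) (s : B) : rep cs (cs.simple s) = sig M s :=
  cs.lift_apply_simple sig_liftable s

/-- Words in `J` act trivially modulo the span of basis vectors lying over `J`. -/
lemma rep_sub_mem (cs : CoxeterSystem M W) (J : Set B) (ω : List B) (hω : ∀ b ∈ ω, b ∈ J)
    (v : Sp B) : rep cs (cs.wordProd ω) v - v ∈ Finsupp.supported ℝ ℝ {p : B × RW B | p.1 ∈ J} := by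
  have key : ∀ s ∈ J, ∀ v : Sp B,
      sig M s v - v ∈ Finsupp.supported ℝ ℝ {p : B × RW B | p.1 ∈ J} := by
    intro s hs v
    induction v using Finsupp.induction_linear with
    | zero => simp
    | add f g hf hg =>
      rw [map_add, add_sub_add_comm]
      exact Submodule.add_mem _ hf hg
    | single p c =>
      have : Finsupp.single p c = c • bv p.1 p.2 := by simp [bv]
      rw [this, map_smul, sig_bv, ← smul_sub, add_sub_cancel_left]
      apply Submodule.smul_mem
      apply Submodule.smul_mem
      exact Finsupp.single_mem_supported ℝ 1 hs
  induction ω with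
  | nil => simp
  | cons s ω ih =>
    rw [cs.wordProd_cons, map_mul, rep_simple, Module.End.mul_apply]
    have h1 := ih (fun b hb => hω b (List.mem_cons_of_mem _ hb))
    have h2 := key s (hω s List.mem_cons_self) (rep cs (cs.wordProd ω) v)
    simpa using Submodule.add_mem _ h2 h1

/-- Words in `J` preserve the span of basis vectors that only involve `J`. -/
lemma rep_mem (cs : CoxeterSystem M W) (J : Set B) (ω : List B) (hω : ∀ b ∈ ω, b ∈ J)
    (v : Sp B)
    (hv : v ∈ Finsupp.supported ℝ ℝ {p : B × RW B | p.1 ∈ J ∧ ∀ e ∈ p.2.1, ∀ b ∈ e, b ∈ J}) :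
    rep cs (cs.wordProd ω) v ∈
      Finsupp.supported ℝ ℝ {p : B × RW B | p.1 ∈ J ∧ ∀ e ∈ p.2.1, ∀ b ∈ e, b ∈ J} := by
  have key : ∀ s ∈ J, Finsupp.supported ℝ ℝ
        {p : B × RW B | p.1 ∈ J ∧ ∀ e ∈ p.2.1, ∀ b ∈ e, b ∈ J} ≤
      (Finsupp.supported ℝ ℝ
        {p : B × RW B | p.1 ∈ J ∧ ∀ e ∈ p.2.1, ∀ b ∈ e, b ∈ J}).comap (sig M s) := by
    intro s hs
    conv_lhs => rw [Finsupp.supported_eq_span_single]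
    rw [Submodule.span_le]
    rintro _ ⟨⟨t, x⟩, ⟨ht, hx⟩, rfl⟩
    rw [SetLike.mem_coe, Submodule.mem_comap]
    change sig M s (bv t x) ∈ Finsupp.supported ℝ ℝ
        {p : B × RW B | p.1 ∈ J ∧ ∀ e ∈ p.2.1, ∀ b ∈ e, b ∈ J}
    rw [sig_bv]
    apply Submodule.add_mem
    · exact Finsupp.single_mem_supported ℝ 1 ⟨ht, hx⟩
    · apply Submodule.smul_mem
      apply Finsupp.single_mem_supported ℝ 1
      refine ⟨hs, fun e he b hb => ?_⟩
      rcases mem_tog _ _ _ he with rfl | h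
      · rcases Sym2.mem_iff.1 hb with rfl | rfl
        · exact hs
        · exact ht
      · exact hx e h b hb
  induction ω with
  | nil => simpa using hv
  | cons s ω ih =>
    rw [cs.wordProd_cons, map_mul, rep_simple, Module.End.mul_apply]
    exact key s (hω s List.mem_cons_self) (ih (fun b hb => hω b (List.mem_cons_of_mem _ hb)))

lemma mem_of_simple_eq (cs : CoxeterSystem M W) (J : Set B) (ω : List B) (hω : ∀ b ∈ ω, b ∈ J)
    (s : B) (h : cs.wordProd ω = cs.simple s) : s ∈ J := by
  have := rep_sub_mem cs J ω hω (bv s ⟨[], by simp⟩)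
  rw [h, rep_simple, sig_self, Finsupp.mem_supported] at this
  apply this (a := (s, ⟨[], by simp⟩))
  simp [bv]
  norm_num

/-! ### Parity of inversions -/

open scoped Classical in
/-- The action of a simple reflection on `W × ZMod 2`. -/
noncomputable def par (cs : CoxeterSystem M W) (s : B) : Function.End (W × ZMod 2) :=
  fun p => (cs.simple s * p.1 * cs.simple s, p.2 + if p.1 = cs.simple s then 1 else 0)

lemma par_apply (cs : CoxeterSystem M W) (s : B) (t : W) (ε : ZMod 2) [Decidable (t = cs.simple s)] :
    par cs s (t, ε) = (cs.simple s * t * cs.simple s, ε + if t = cs.simple s then 1 else 0) := by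
  simp only [par]
  congr

lemma invol_aux (a b t : W) (hi : a * a = 1) (hj : b * b = 1) (k : ℕ) :
    ((a * b) ^ k * t * ((a * b) ^ k)⁻¹ = b ↔ t = b * (a * b) ^ (2 * k)) ∧
    (b * ((a * b) ^ k * t * ((a * b) ^ k)⁻¹) * b = a ↔ t = b * (a * b) ^ (2 * k + 1)) := by
  have ii : a⁻¹ = a := inv_eq_of_mul_eq_one_right hi
  have ij : b⁻¹ = b := inv_eq_of_mul_eq_one_right hj
  have hb1 : SemiconjBy b (a * b) (a * b)⁻¹ := by
    change b * (a * b) = (a * b)⁻¹ * b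
    rw [mul_inv_rev, ii, ij, mul_assoc]
  have hrel : ∀ k : ℕ, b * (a * b) ^ k = ((a * b) ^ k)⁻¹ * b := by
    intro k
    have := (hb1.pow_right k).eq
    rwa [inv_pow] at this
  refine ⟨?_, ?_⟩
  · rw [two_mul, pow_add, ← mul_assoc, hrel k, mul_inv_eq_iff_eq_mul, mul_assoc,
      ← eq_inv_mul_iff_mul_eq]
  · have e : b * (a * b) ^ (2 * k + 1) = ((a * b) ^ k)⁻¹ * (b * (a * b)) * (a * b) ^ k := by
      rw [← mul_assoc, ← hrel k, show 2 * k + 1 = k + 1 + k by ring, pow_add, pow_succ]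
      simp only [mul_assoc]
    rw [e]
    generalize (a * b) ^ k = r
    constructor
    · intro h
      have h' : r * t * r⁻¹ = b * (a * b) := by
        rw [← h]
        simp only [mul_assoc, hj, mul_one]
        rw [← mul_assoc b b, hj, one_mul]
      rw [← h']
      group
    · intro h
      have h' : r * t * r⁻¹ = b * (a * b) := by
        rw [h]; group
      rw [h', ← mul_assoc, hj, one_mul, mul_assoc, hj, mul_one]

open scoped Classical in
lemma par_pow (cs : CoxeterSystem M W) (i j : B) (k : ℕ) (t : W) (ε : ZMod 2) :
    ((par cs i * par cs j) ^ k) (t, ε) =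
      ((cs.simple i * cs.simple j) ^ k * t * ((cs.simple i * cs.simple j) ^ k)⁻¹,
        ε + ∑ c ∈ Finset.range (2 * k),
          if t = cs.simple j * (cs.simple i * cs.simple j) ^ c then 1 else 0) := by
  induction k with
  | zero => simp; rfl
  | succ k ih =>
    obtain ⟨c1, c2⟩ := invol_aux (cs.simple i) (cs.simple j) t (cs.simple_mul_simple_self i)
      (cs.simple_mul_simple_self j) k
    rw [pow_succ']
    change par cs i (par cs j (((par cs i * par cs j) ^ k) (t, ε))) = _
    rw [ih, par_apply, par_apply]
    refine Prod.ext ?_ ?_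
    · simp only [pow_succ', mul_inv_rev, cs.inv_simple, mul_assoc]
    · simp only [c1, c2]
      rw [show 2 * (k + 1) = 2 * k + 1 + 1 by ring, Finset.sum_range_succ, Finset.sum_range_succ]
      ring

lemma par_liftable (cs : CoxeterSystem M W) : M.IsLiftable (par cs) := by
  classical
  intro i j
  funext ⟨t, ε⟩
  rw [par_pow, two_mul, Finset.sum_range_add]
  simp only [pow_add, cs.simple_mul_simple_pow, one_mul, inv_one, mul_one]
  rw [CharTwo.add_self_eq_zero, add_zero]
  rfl

open scoped Classical in
lemma par_word (cs : CoxeterSystem M W) (ω : List B) (t : W) (ε : ZMod 2) :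
    (cs.lift ⟨par cs, par_liftable cs⟩ (cs.wordProd ω)) (t, ε) =
      (cs.wordProd ω * t * (cs.wordProd ω)⁻¹, ε + ((cs.rightInvSeq ω).count t : ℕ)) := by
  induction ω with
  | nil => simp; rfl
  | cons i ω ih =>
    rw [cs.wordProd_cons, map_mul, cs.lift_apply_simple]
    change par cs i (cs.lift ⟨par cs, par_liftable cs⟩ (cs.wordProd ω) (t, ε)) = _
    rw [ih]
    simp only [par, CoxeterSystem.rightInvSeq]
    refine Prod.ext ?_ ?_
    · simp [mul_assoc]
    · have : cs.wordProd ω * t * (cs.wordProd ω)⁻¹ = cs.simple i ↔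
          (cs.wordProd ω)⁻¹ * cs.simple i * cs.wordProd ω = t := by
        constructor
        · intro h; rw [← h]; group
        · intro h; rw [← h]; group
      simp only [this, List.count_cons, beq_iff_eq]
      split_ifs <;> push_cast <;> ring

lemma mem_rightInvSeq_of_eq (cs : CoxeterSystem M W) {ω ω' : List B} (hω : cs.IsReduced ω)
    (h : cs.wordProd ω = cs.wordProd ω') {t : W} (ht : t ∈ cs.rightInvSeq ω) :
    t ∈ cs.rightInvSeq ω' := by
  classical
  have h1 := par_word cs ω t 0
  rw [h, par_word cs ω' t 0] at h1
  have h2 := (Prod.ext_iff.1 h1).2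
  simp only [zero_add] at h2
  rw [List.count_eq_one_of_mem hω.nodup_rightInvSeq ht] at h2
  by_contra hn
  rw [List.count_eq_zero_of_not_mem hn] at h2
  simp at h2

lemma rightInvSeq_mem (cs : CoxeterSystem M W) (H : Subgroup W) (ω : List B)
    (hω : ∀ b ∈ ω, cs.simple b ∈ H) :
    cs.wordProd ω ∈ H ∧ ∀ t ∈ cs.rightInvSeq ω, t ∈ H := by
  induction ω with
  | nil => simp [H.one_mem]
  | cons i ω ih =>
    have ⟨h1, h2⟩ := ih (fun b hb => hω b (List.mem_cons_of_mem _ hb))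
    have hi := hω i List.mem_cons_self
    refine ⟨?_, ?_⟩
    · rw [cs.wordProd_cons]; exact H.mul_mem hi h1
    · intro t ht
      rw [CoxeterSystem.rightInvSeq] at ht
      rcases List.mem_cons.1 ht with rfl | ht
      · exact H.mul_mem (H.mul_mem (H.inv_mem h1) hi) h1
      · exact h2 t ht

lemma letters_mem (cs : CoxeterSystem M W) (H : Subgroup W) (ω : List B)
    (hω : ∀ t ∈ cs.rightInvSeq ω, t ∈ H) : ∀ b ∈ ω, cs.simple b ∈ H := by
  induction ω with
  | nil => simp
  | cons i ω ih =>
    rw [CoxeterSystem.rightInvSeq] at hω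
    have h1 := ih (fun t ht => hω t (List.mem_cons_of_mem _ ht))
    have h2 := (rightInvSeq_mem cs H ω h1).1
    have h3 := hω _ List.mem_cons_self
    intro b hb
    rcases List.mem_cons.1 hb with rfl | hb
    · have := H.mul_mem (H.mul_mem h2 h3) (H.inv_mem h2)
      have e : cs.wordProd ω * ((cs.wordProd ω)⁻¹ * cs.simple b * cs.wordProd ω) *
          (cs.wordProd ω)⁻¹ = cs.simple b := by group
      rwa [e] at this
    · exact h1 b hb

/-- The standard parabolic subgroup. -/
def parab (cs : CoxeterSystem M W) (J : Set B) : Subgroup W where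
  carrier := {w | ∃ ω : List B, (∀ b ∈ ω, b ∈ J) ∧ cs.wordProd ω = w}
  one_mem' := ⟨[], by simp, by simp⟩
  mul_mem' := by
    rintro _ _ ⟨ω, h, rfl⟩ ⟨ω', h', rfl⟩
    refine ⟨ω ++ ω', ?_, cs.wordProd_append _ _⟩
    intro b hb
    rcases List.mem_append.1 hb with hb | hb
    · exact h b hb
    · exact h' b hb
  inv_mem' := by
    rintro _ ⟨ω, h, rfl⟩
    exact ⟨ω.reverse, fun b hb => h b (List.mem_reverse.1 hb), cs.wordProd_reverse _⟩

lemma simple_mem_parab (cs : CoxeterSystem M W) (J : Set B) (b : B) (hb : b ∈ J) :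
    cs.simple b ∈ parab cs J := ⟨[b], by simpa using hb, by simp⟩

lemma letters_of_mem_parab (cs : CoxeterSystem M W) (J : Set B) (ω : List B)
    (hω : cs.IsReduced ω) (h : cs.wordProd ω ∈ parab cs J) : ∀ b ∈ ω, b ∈ J := by
  obtain ⟨ω', h1, h2⟩ := h
  intro b hb
  have h3 := (rightInvSeq_mem cs (parab cs J) ω' (fun b hb => simple_mem_parab cs J b (h1 b hb))).2
  obtain ⟨ω'', h4, h5⟩ := letters_mem cs (parab cs J) ω
    (fun t ht => h3 t (mem_rightInvSeq_of_eq cs hω h2.symm ht)) b hb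
  exact mem_of_simple_eq cs J ω'' h4 b h5

/-- The action of the path element on the last basis vector. -/
lemma rep_path (cs : CoxeterSystem M W) (n : ℕ) (y : ℕ → B)
    (hadj : ∀ i < n, y i ≠ y (i + 1) ∧ Odd (M (y i) (y (i + 1))))
    (hnb : ∀ i, i + 2 ≤ n → y (i + 2) ≠ y i)
    (w : ℕ → W)
    (hw : ∀ i < n,
      w i = (cs.simple (y (i + 1)) * cs.simple (y i)) ^ ((M (y i) (y (i + 1)) - 1) / 2)) :
    ∃ h : (List.ofFn fun i : Fin n => s(y i, y (i + 1))).IsChain (· ≠ ·),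
    rep cs (List.ofFn fun i : Fin n => w i).prod (bv (y n) ⟨[], by simp⟩) =
      bv (y 0) ⟨List.ofFn fun i : Fin n => s(y i, y (i + 1)), h⟩ := by
  induction n generalizing y w with
  | zero => simp
  | succ n ih =>
    obtain ⟨h, he⟩ := ih (fun i => y (i + 1)) (fun i hi => hadj (i + 1) (by omega))
      (fun i hi => hnb (i + 1) (by omega)) (fun i => w (i + 1))
      (fun i hi => hw (i + 1) (by omega))
    have hch : (s(y 0, y 1) :: List.ofFn fun i : Fin n => s(y (i + 1), y (i + 1 + 1))).IsChain
        (· ≠ ·) := by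
      cases n with
      | zero => simp
      | succ n =>
        rw [List.ofFn_succ] at h ⊢
        refine List.isChain_cons_cons.2 ⟨?_, h⟩
        intro heq
        have h1 := hnb 0 (by omega)
        have h2 := (hadj 0 (by omega)).1
        simp only [Fin.val_zero, zero_add] at heq h1 h2
        rw [Sym2.eq_iff] at heq
        rcases heq with ⟨h3, -⟩ | ⟨h3, -⟩
        · exact h2 h3
        · exact h1 h3.symm
    have hl : (List.ofFn fun i : Fin (n + 1) => s(y i, y (i + 1))) =
        s(y 0, y 1) :: List.ofFn fun i : Fin n => s(y (i + 1), y (i + 1 + 1)) := by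
      rw [List.ofFn_succ]; simp
    have hl' : (List.ofFn fun i : Fin (n + 1) => w i) =
        w 0 :: List.ofFn fun i : Fin n => w (i + 1) := by
      rw [List.ofFn_succ]; simp
    refine ⟨by rw [hl]; exact hch, ?_⟩
    simp only [hl, hl']
    rw [List.prod_cons, map_mul, Module.End.mul_apply, he]
    have ⟨hne, ho⟩ := hadj 0 (by omega)
    obtain ⟨l, hm⟩ := ho
    rw [hw 0 (by omega), map_pow, map_mul, rep_simple, rep_simple]
    have := (sig_dihedral (y 0) (y (0 + 1)) hne ⟨l, hm⟩ ⟨_, hch⟩).2.2 l hm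
    rw [show (M (y 0) (y (0 + 1)) - 1) / 2 = l by omega, ← this]
    congr 2
    rw [← tog_cons s(y 0, y 1) (by simpa using hne) _ h hch, tog_tog]

end OddPath


/-- Let `y 0, y 1, …, y n` (`n ≥ 1`) be a non-backtracking path in the odd Coxeter graph of
`(W,S)`, and put `w = w 0 * w 1 * ⋯ * w (n-1)` where
`w i = (y (i+1) * y i) ^ ((m i - 1)/2)`.  Then the support of `w` is `{y 0, …, y n}`: the set of
letters occurring in any reduced word for `w` is exactly `{y 0, …, y n}`. -/
theorem stmt_6 {B W : Type*} [Group W] {M : CoxeterMatrix B} (cs : CoxeterSystem M W)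
    (n : ℕ) (hn : 1 ≤ n) (y : ℕ → B)
    (hadj : ∀ i < n, y i ≠ y (i + 1) ∧ Odd (M (y i) (y (i + 1))))
    (hnb : ∀ i, i + 2 ≤ n → y (i + 2) ≠ y i)
    (w : ℕ → W)
    (hw : ∀ i < n,
      w i = (cs.simple (y (i + 1)) * cs.simple (y i)) ^ ((M (y i) (y (i + 1)) - 1) / 2))
    (ω : List B) (hred : cs.IsReduced ω)
    (hprod : cs.wordProd ω = (List.ofFn fun i : Fin n => w i).prod) :
    {b | b ∈ ω} = {b | ∃ i ≤ n, y i = b} := by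
  apply Set.Subset.antisymm
  · intro b hb
    refine OddPath.letters_of_mem_parab cs {b | ∃ i ≤ n, y i = b} ω hred ?_ b hb
    rw [hprod]
    apply Subgroup.list_prod_mem
    intro x hx
    obtain ⟨i, rfl⟩ := (List.mem_ofFn' _ _).1 hx
    change w i ∈ _
    rw [hw i i.2]
    apply Subgroup.pow_mem
    apply Subgroup.mul_mem
    · exact OddPath.simple_mem_parab cs _ _ ⟨i + 1, i.2, rfl⟩
    · exact OddPath.simple_mem_parab cs _ _ ⟨i, i.2.le, rfl⟩
  · obtain ⟨h, he⟩ := OddPath.rep_path cs n y hadj hnb w hw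
    rw [← hprod] at he
    by_cases hy : y n ∈ ω
    · have := OddPath.rep_mem cs {b | b ∈ ω} ω (fun b hb => hb)
        (OddPath.bv (y n) ⟨[], by simp⟩)
        (Finsupp.single_mem_supported ℝ 1 ⟨hy, by simp⟩)
      rw [he, Finsupp.mem_supported] at this
      have h2 := (this (a := (y 0, ⟨_, h⟩)) (by simp [OddPath.bv])).2
      rintro b ⟨i, hi, rfl⟩
      rcases hi.lt_or_eq with hi | rfl
      · exact h2 s(y i, y (i + 1)) ((List.mem_ofFn' _ _).2 ⟨⟨i, hi⟩, rfl⟩) _ (by simp)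
      · exact hy
    · exfalso
      have := OddPath.rep_sub_mem cs {b | b ∈ ω} ω (fun b hb => hb)
        (OddPath.bv (y n) ⟨[], by simp⟩)
      rw [he, Finsupp.mem_supported] at this
      apply hy
      apply this (a := (y n, ⟨[], by simp⟩))
      have hne : List.ofFn (fun i : Fin n => s(y i, y (i + 1))) ≠ [] := by
        intro h0
        have := congrArg List.length h0
        simp at this
        omega
      rw [Finset.mem_coe, Finsupp.mem_support_iff]
      simp [OddPath.bv, hne]
end

section
/- Let (W,S) be a Coxeter system and let H be a maximal finite subgroup of W (H is a finite subgroup that is not properly contained in any finite subgroup of W). Then H is a parabolic subgroup of W: there exist w ∈ W and I ⊆ S with W_I finite such that H = w W_I w⁻¹ (hence H is a maximal finite parabolic subgroup of W). -/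
namespace GeomRep

open Module

variable {B W : Type*} [Group W] {M : CoxeterMatrix B}

/-- Entries of the (doubled) canonical bilinear form. -/
noncomputable def kf (M : CoxeterMatrix B) (s t : B) : ℝ := -(2 * Real.cos (Real.pi / (M s t : ℝ)))

lemma kf_symm (s t : B) : kf M s t = kf M t s := by
  unfold kf; rw [M.symmetric s t]

lemma kf_self (s : B) : kf M s s = 2 := by
  simp [kf]

/-- The simple root. -/
noncomputable def al (s : B) : B →₀ ℝ := Finsupp.single s 1

/-- The coroot functional. -/
noncomputable def fc (M : CoxeterMatrix B) (s : B) : Dual ℝ (B →₀ ℝ) :=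
  Finsupp.linearCombination ℝ (kf M s)

lemma fc_al (s t : B) : fc M s (al t) = kf M s t := by
  simp [fc, al]

lemma fc_self (s : B) : fc M s (al s) = 2 := by rw [fc_al, kf_self]

/-- The simple reflection as a linear equivalence. -/
noncomputable def sg (M : CoxeterMatrix B) (s : B) : (B →₀ ℝ) ≃ₗ[ℝ] (B →₀ ℝ) :=
  reflection (fc_self (M := M) s)

lemma sg_apply (s : B) (v : B →₀ ℝ) : sg M s v = v - fc M s v • al s := reflection_apply _ _

lemma liftable (M : CoxeterMatrix B) : M.IsLiftable (sg M) := by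
  intro s t
  rcases eq_or_ne (M s t) 0 with h0 | h0
  · rw [h0, pow_zero]
  by_cases hst : s = t
  · subst hst
    simp only [M.diagonal, pow_one]
    ext1 v
    exact involutive_reflection (fc_self (M := M) s) v
  have h1 := M.off_diagonal s t hst
  change M s t ≠ 1 at h1
  ext1 v
  by_cases h2 : M s t = 2
  · rw [h2]
    have hk : kf M s t = 0 := by simp [kf, h2]
    have hk' : kf M t s = 0 := by rw [kf_symm, hk]
    simp only [pow_two, LinearEquiv.mul_apply, sg_apply, map_sub, map_smul, fc_al, kf_self, hk, hk',
      LinearEquiv.coe_one, id]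
    module
  have h3 : 3 ≤ M s t := by omega
  set m := M s t with hm
  have hmpos : (0 : ℝ) < m := by positivity
  set θ : ℝ := 2 * (Real.pi / m) with hθ
  have hmθ : (m : ℝ) * θ = 2 * Real.pi := by rw [hθ]; field_simp
  have hsin : 0 < Real.sin θ := by
    apply Real.sin_pos_of_pos_of_lt_pi
    · have := Real.pi_pos; positivity
    · have h3' : (3 : ℝ) ≤ m := by exact_mod_cast h3
      have := Real.pi_pos
      nlinarith
  have ht : 2 * Real.cos θ = fc M s (al t) * fc M t (al s) - 2 := by
    rw [fc_al, fc_al, kf_symm t s, hθ, Real.cos_two_mul, kf]; ring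
  have key := reflection_mul_reflection_pow_apply (fc_self (M := M) s) (fc_self (M := M) t) m v
    (2 * Real.cos θ) ht
  have hS := fun n : ℤ => Polynomial.Chebyshev.S_two_mul_real_cos θ n
  change ((sg M s * sg M t) ^ m) v = _ at key
  rw [key]
  clear key
  rcases Nat.even_or_odd' m with ⟨k, hk | hk⟩
  · have e1 : ((m : ℤ) - 2) / 2 = k - 1 := by omega
    have e2 : ((m : ℤ) - 1) / 2 = k - 1 := by omega
    have z : (Polynomial.Chebyshev.S ℝ ((k : ℤ) - 1)).eval (2 * Real.cos θ) = 0 := by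
      have := hS (k - 1)
      push_cast at this
      have h : ((k : ℝ) - 1 + 1) * θ = Real.pi := by
        have : (m : ℝ) = 2 * k := by exact_mod_cast hk
        rw [this] at hmθ; linarith
      rw [h, Real.sin_pi] at this
      exact (mul_eq_zero.mp this).resolve_right hsin.ne'
    rw [e1, e2, z]; simp
  · have e1 : ((m : ℤ) - 2) / 2 = k - 1 := by omega
    have e2 : ((m : ℤ) - 1) / 2 = k := by omega
    have e3 : ((m : ℤ) - 3) / 2 = k - 1 := by omega
    have e4 : (m : ℤ) / 2 = k := by omega
    have z : (Polynomial.Chebyshev.S ℝ (k : ℤ)).eval (2 * Real.cos θ)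
        + (Polynomial.Chebyshev.S ℝ ((k : ℤ) - 1)).eval (2 * Real.cos θ) = 0 := by
      have a1 := hS (k - 1)
      have a2 := hS k
      push_cast at a1 a2
      have h : ((k : ℝ) + 1) * θ = 2 * Real.pi - ((k : ℝ) - 1 + 1) * θ := by
        have : (m : ℝ) = 2 * k + 1 := by exact_mod_cast hk
        rw [this] at hmθ; linarith
      rw [h, Real.sin_two_pi_sub] at a2
      have : ((Polynomial.Chebyshev.S ℝ (k : ℤ)).eval (2 * Real.cos θ)
        + (Polynomial.Chebyshev.S ℝ ((k : ℤ) - 1)).eval (2 * Real.cos θ)) * Real.sin θ = 0 := by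
        rw [add_mul, a1, a2]; ring
      exact (mul_eq_zero.mp this).resolve_right hsin.ne'
    rw [e1, e2, e3, e4, z]; simp

variable (cs : CoxeterSystem M W)

/-- The geometric representation. -/
noncomputable def rp : W →* ((B →₀ ℝ) ≃ₗ[ℝ] (B →₀ ℝ)) := cs.lift ⟨sg M, liftable M⟩

lemma rp_simple (s : B) : rp cs (cs.simple s) = sg M s := cs.lift_apply_simple (liftable M) s

lemma rp_mul (u v : W) (x : B →₀ ℝ) : rp cs (u * v) x = rp cs u (rp cs v x) := by
  rw [map_mul]; rfl

lemma rp_one (x : B →₀ ℝ) : rp cs 1 x = x := by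
  rw [map_one]; rfl

/-- Dihedral coefficients. -/
noncomputable def ac (m k : ℕ) : ℝ :=
  if m = 0 then k else Real.sin (k * (Real.pi / m)) / Real.sin (Real.pi / m)

lemma sin_pos' {m : ℕ} (h0 : m ≠ 0) (h1 : m ≠ 1) : 0 < Real.sin (Real.pi / m) := by
  have h2 : (2 : ℝ) ≤ m := by exact_mod_cast (by omega : 2 ≤ m)
  have := Real.pi_pos
  apply Real.sin_pos_of_pos_of_lt_pi
  · positivity
  · rw [div_lt_iff₀ (by linarith)]; nlinarith

lemma ac_nonneg {m k : ℕ} (h1 : m ≠ 1) (h : m = 0 ∨ k ≤ m) : 0 ≤ ac m k := by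
  unfold ac
  split_ifs with h0
  · positivity
  · have hk : (k : ℝ) ≤ m := by exact_mod_cast h.resolve_left h0
    have := Real.pi_pos
    have hm : (0 : ℝ) < m := by positivity
    refine div_nonneg (Real.sin_nonneg_of_nonneg_of_le_pi (by positivity) ?_) (sin_pos' h0 h1).le
    rw [mul_div_assoc', div_le_iff₀ hm]; nlinarith

lemma ac_rec {m : ℕ} (h1 : m ≠ 1) (k : ℕ) :
    ac m (k + 2) = 2 * Real.cos (Real.pi / m) * ac m (k + 1) - ac m k := by
  unfold ac
  split_ifs with h0
  · subst h0; push_cast; simp; ring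
  · have := (sin_pos' h0 h1).ne'
    generalize Real.pi / (m : ℝ) = x at *
    field_simp
    push_cast
    have e1 : ((k : ℝ) + 2) * x = (k + 1) * x + x := by ring
    have e2 : x * (k : ℝ) = (k + 1) * x - x := by ring
    have e3 : x * ((k : ℝ) + 1) = (k + 1) * x := by ring
    rw [e1, e2, e3, Real.sin_add, Real.sin_sub]; ring

lemma ac_one {m : ℕ} (h1 : m ≠ 1) : ac m 1 = 1 := by
  unfold ac
  split_ifs with h0
  · simp
  · have := (sin_pos' h0 h1).ne'
    simp [this]

lemma ac_zero {m : ℕ} : ac m 0 = 0 := by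
  unfold ac; simp

lemma rp_alt {s t : B} (hst : s ≠ t) (k : ℕ) :
    rp cs (cs.wordProd (CoxeterSystem.alternatingWord s t k)) (al s) =
      ac (M s t) (k + 1) • al (if Even k then s else t) +
        ac (M s t) k • al (if Even k then t else s) := by
  have h1 : M s t ≠ 1 := M.off_diagonal s t hst
  induction k with
  | zero => simp [ac_zero, ac_one h1, CoxeterSystem.alternatingWord]
  | succ k ih =>
    rw [CoxeterSystem.alternatingWord_succ', cs.wordProd_cons, rp_mul, ih, rp_simple, sg_apply,
      ac_rec h1]
    have e : 2 * Real.cos (Real.pi / (M s t : ℝ)) = - kf M s t := by simp [kf]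
    rw [e]
    by_cases hk : Even k
    · simp only [hk, Nat.even_add_one, not_true, if_true, if_false, map_add, map_smul, fc_al,
        kf_self, kf_symm t s, smul_eq_mul]
      module
    · simp only [hk, Nat.even_add_one, not_false_eq_true, if_true, if_false, map_add, map_smul,
        fc_al, kf_self, smul_eq_mul]
      module

/-- Positive vectors. -/
def Pos (v : B →₀ ℝ) : Prop := ∀ b, 0 ≤ v b

lemma pos_comb {a b : ℝ} {u v : B →₀ ℝ} (ha : 0 ≤ a) (hb : 0 ≤ b) (hu : Pos u) (hv : Pos v) :
    Pos (a • u + b • v) := by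
  intro c
  have := hu c
  have := hv c
  simp only [Finsupp.add_apply, Finsupp.smul_apply, smul_eq_mul]
  positivity

lemma pos_al (s : B) : Pos (al s) := by
  classical
  intro b
  unfold al
  rw [Finsupp.single_apply]; split_ifs <;> norm_num

lemma exists_strip {s t : B} (hst : s ≠ t) {w : W} (hs : ¬ cs.IsRightDescent w s) (n : ℕ) :
    ∀ (v : W) (k : ℕ), cs.length v = n → 1 ≤ k → (M s t = 0 ∨ k < M s t) →
      w = v * cs.wordProd (CoxeterSystem.alternatingWord s t k) →
      cs.length w = cs.length v + k →
      ∃ (v : W) (k : ℕ), 1 ≤ k ∧ (M s t = 0 ∨ k < M s t) ∧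
        w = v * cs.wordProd (CoxeterSystem.alternatingWord s t k) ∧
        cs.length w = cs.length v + k ∧ ¬ cs.IsRightDescent v (if Even k then t else s) := by
  induction n with
  | zero =>
    intro v k hv hk hm hw hl
    refine ⟨v, k, hk, hm, hw, hl, ?_⟩
    rw [cs.length_eq_zero_iff] at hv
    subst hv
    exact cs.not_isRightDescent_one _
  | succ n ih =>
    intro v k hv hk hm hw hl
    by_cases hd : cs.IsRightDescent v (if Even k then t else s)
    · have hd' := cs.isRightDescent_iff.mp hd
      have hw' : w = v * cs.simple (if Even k then t else s) *
          cs.wordProd (CoxeterSystem.alternatingWord s t (k + 1)) := by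
        rw [CoxeterSystem.alternatingWord_succ', cs.wordProd_cons, ← mul_assoc,
          cs.simple_mul_simple_cancel_right]
        exact hw
      refine ih _ (k + 1) (by omega) (by omega) ?_ hw' (by omega)
      rcases hm with hm | hm
      · exact Or.inl hm
      right
      refine lt_of_le_of_ne hm ?_
      intro he
      apply hs
      have hb := cs.wordProd_braidWord_eq s t
      unfold CoxeterSystem.braidWord at hb
      rw [M.symmetric t s, ← he] at hb
      rw [hb, CoxeterSystem.alternatingWord_succ, cs.wordProd_concat, ← mul_assoc] at hw'
      have hws : w * cs.simple s = v * cs.simple (if Even k then t else s) *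
          cs.wordProd (CoxeterSystem.alternatingWord s t k) := by
        rw [hw', cs.simple_mul_simple_cancel_right]
      unfold CoxeterSystem.IsRightDescent
      rw [hws]
      have l1 := cs.length_mul_le (v * cs.simple (if Even k then t else s))
        (cs.wordProd (CoxeterSystem.alternatingWord s t k))
      have l2 := cs.length_wordProd_le (CoxeterSystem.alternatingWord s t k)
      rw [CoxeterSystem.length_alternatingWord] at l2
      omega
    · exact ⟨v, k, hk, hm, hw, hl, hd⟩

theorem pos_of_not_descent (n : ℕ) : ∀ (w : W) (s : B), cs.length w = n →
    ¬ cs.IsRightDescent w s → Pos (rp cs w (al s)) := by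
  induction n using Nat.strong_induction_on with
  | _ n ih =>
    intro w s hn hs
    by_cases hw1 : w = 1
    · subst hw1; rw [rp_one]; exact pos_al s
    obtain ⟨t, ht⟩ := cs.exists_rightDescent_of_ne_one hw1
    have hst : s ≠ t := by rintro rfl; exact hs ht
    have h1 : M s t ≠ 1 := M.off_diagonal s t hst
    have ht' := cs.isRightDescent_iff.mp ht
    obtain ⟨v, k, hk, hm, hw, hl, hd⟩ := exists_strip cs hst hs _ (w * cs.simple t) 1 rfl le_rfl
      (by omega) (by simp [CoxeterSystem.alternatingWord]) (by omega)
    have hd2 : ¬ cs.IsRightDescent v (if Even k then s else t) := by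
      intro hd2
      have hd2' := cs.isRightDescent_iff.mp hd2
      obtain ⟨j, rfl⟩ : ∃ j, k = j + 1 := ⟨k - 1, by omega⟩
      have e : (if Even (j + 1) then s else t) = if Even j then t else s := by
        by_cases hj : Even j <;> simp [hj, Nat.even_add_one, -Nat.not_even_iff_odd]
      rw [e] at hd2'
      rw [CoxeterSystem.alternatingWord_succ', cs.wordProd_cons, ← mul_assoc] at hw
      have l1 := cs.length_mul_le (v * cs.simple (if Even j then t else s))
        (cs.wordProd (CoxeterSystem.alternatingWord s t j))
      have l2 := cs.length_wordProd_le (CoxeterSystem.alternatingWord s t j)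
      rw [CoxeterSystem.length_alternatingWord] at l2
      rw [← hw] at l1
      omega
    have p1 := ih (cs.length v) (by omega) v _ rfl hd
    have p2 := ih (cs.length v) (by omega) v _ rfl hd2
    rw [hw, rp_mul, rp_alt cs hst, map_add, map_smul, map_smul]
    exact pos_comb (ac_nonneg h1 (by omega)) (ac_nonneg h1 (by omega)) p2 p1

lemma rp_simple_self (s : B) : rp cs (cs.simple s) (al s) = - al s := by
  rw [rp_simple, sg_apply, fc_self]; module

theorem neg_of_descent {w : W} {s : B} (h : cs.IsRightDescent w s) :
    Pos (- rp cs w (al s)) := by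
  have h' := cs.isRightDescent_iff_not_isRightDescent_mul.mp h
  have := pos_of_not_descent cs _ _ _ rfl h'
  rwa [rp_mul, rp_simple_self, map_neg] at this

lemma descent_or (w : W) (s : B) : Pos (rp cs w (al s)) ∨ Pos (- rp cs w (al s)) := by
  by_cases h : cs.IsRightDescent w s
  · exact Or.inr (neg_of_descent cs h)
  · exact Or.inl (pos_of_not_descent cs _ _ _ rfl h)

/-- The root system. -/
def Root : Set (B →₀ ℝ) := {β | ∃ (w : W) (s : B), β = rp cs w (al s)}

lemma root_al (s : B) : al s ∈ Root cs := ⟨1, s, by rw [rp_one]⟩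

lemma root_map {β : B →₀ ℝ} (h : β ∈ Root cs) (u : W) : rp cs u β ∈ Root cs := by
  obtain ⟨w, s, rfl⟩ := h
  exact ⟨u * w, s, by rw [rp_mul]⟩

lemma root_neg {β : B →₀ ℝ} (h : β ∈ Root cs) : -β ∈ Root cs := by
  obtain ⟨w, s, rfl⟩ := h
  exact ⟨w * cs.simple s, s, by rw [rp_mul, rp_simple_self, map_neg]⟩

lemma root_or {β : B →₀ ℝ} (h : β ∈ Root cs) : Pos β ∨ Pos (-β) := by
  obtain ⟨w, s, rfl⟩ := h
  exact descent_or cs w s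

lemma al_ne_zero (s : B) : (al s : B →₀ ℝ) ≠ 0 := by
  simp [al]

lemma root_ne_zero {β : B →₀ ℝ} (h : β ∈ Root cs) : β ≠ 0 := by
  obtain ⟨w, s, rfl⟩ := h
  simpa using al_ne_zero s

lemma not_both {β : B →₀ ℝ} (h1 : Pos β) (h2 : Pos (-β)) : β = 0 := by
  ext b
  have := h1 b
  have := h2 b
  simp at *
  linarith

/-- The bilinear form. -/
noncomputable def bf (M : CoxeterMatrix B) : (B →₀ ℝ) →ₗ[ℝ] (B →₀ ℝ) →ₗ[ℝ] ℝ :=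
  Finsupp.linearCombination ℝ (fc M)

lemma bf_al (s : B) (v : B →₀ ℝ) : bf M (al s) v = fc M s v := by
  simp [bf, al]

lemma bf_al' (s : B) (v : B →₀ ℝ) : bf M v (al s) = fc M s v := by
  induction v using Finsupp.induction_linear with
  | zero => simp
  | add u v hu hv => simp [hu, hv]
  | single t a =>
    have : (Finsupp.single t a : B →₀ ℝ) = a • al t := by simp [al]
    rw [this, map_smul, map_smul, LinearMap.smul_apply, bf_al, fc_al, fc_al, kf_symm]

lemma bf_sg (s : B) (v : B →₀ ℝ) : bf M (sg M s v) (sg M s v) = bf M v v := by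
  rw [sg_apply]
  simp only [map_sub, map_smul, LinearMap.sub_apply, LinearMap.smul_apply, bf_al, bf_al', fc_self,
    smul_eq_mul]
  ring

lemma bf_rp (w : W) (v : B →₀ ℝ) : bf M (rp cs w v) (rp cs w v) = bf M v v := by
  induction w using cs.simple_induction_left with
  | one => rw [rp_one]
  | mul_simple_left w s ih => rw [rp_mul, rp_simple, bf_sg, ih]

lemma bf_root {β : B →₀ ℝ} (h : β ∈ Root cs) : bf M β β = 2 := by
  obtain ⟨w, s, rfl⟩ := h
  rw [bf_rp, bf_al, fc_self]

/-- A simple reflection permutes the positive roots other than the simple root. -/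
lemma simple_pos {β : B →₀ ℝ} (h : β ∈ Root cs) (hp : Pos β) {s : B} (hne : β ≠ al s) :
    Pos (rp cs (cs.simple s) β) := by
  classical
  refine (root_or cs (root_map cs h (cs.simple s))).resolve_right ?_
  intro hn
  have hz : ∀ t, t ≠ s → β t = 0 := by
    intro t ht
    have h1 := hp t
    have h2 := hn t
    rw [rp_simple, sg_apply] at h2
    have : (al s : B →₀ ℝ) t = 0 := by simp [al, ht]
    simp [this] at h2
    linarith
  have hβ : β = (β s) • al s := by
    ext t
    by_cases ht : t = s
    · subst ht; simp [al]
    · rw [hz t ht]; simp [al, ht]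
  have hb := bf_root cs h
  have hs := hp s
  generalize β s = c at *
  subst hβ
  simp only [map_smul, LinearMap.smul_apply, bf_al, fc_self, smul_eq_mul] at hb
  have hc : c = 1 := by nlinarith
  exact hne (by rw [hc, one_smul])

lemma finite_inv (w : W) : {β | β ∈ Root cs ∧ Pos β ∧ Pos (- rp cs w β)}.Finite := by
  induction w using cs.simple_induction_right with
  | one =>
    convert Set.finite_empty
    rw [Set.eq_empty_iff_forall_notMem]
    rintro β ⟨h1, h2, h3⟩
    rw [rp_one] at h3
    exact root_ne_zero cs h1 (not_both h2 h3)
  | mul_simple_right w s ih =>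
    refine ((ih.image (rp cs (cs.simple s))).union (Set.finite_singleton (al s))).subset ?_
    rintro β ⟨h1, h2, h3⟩
    by_cases hβ : β = al s
    · exact Or.inr hβ
    left
    refine ⟨rp cs (cs.simple s) β, ⟨root_map cs h1 _, simple_pos cs h1 h2 hβ, ?_⟩, ?_⟩
    · rwa [rp_mul] at h3
    · rw [← rp_mul, cs.simple_mul_simple_self, rp_one]

/-- Positive roots on which a functional is negative. -/
def NegSet (x : Dual ℝ (B →₀ ℝ)) : Set (B →₀ ℝ) := {β | β ∈ Root cs ∧ Pos β ∧ x β < 0}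

lemma exists_dominant (n : ℕ) : ∀ x : Dual ℝ (B →₀ ℝ), (NegSet cs x).Finite →
    (NegSet cs x).ncard = n → ∃ w : W, ∀ s, 0 ≤ x (rp cs w (al s)) := by
  induction n using Nat.strong_induction_on with
  | _ n ih =>
    intro x hf hn
    by_cases hd : ∀ s, 0 ≤ x (al s)
    · exact ⟨1, fun s => by rw [rp_one]; exact hd s⟩
    push Not at hd
    obtain ⟨s, hs⟩ := hd
    set σ := rp cs (cs.simple s) with hσ
    have hinv : ∀ v, σ (σ v) = v := fun v => by
      rw [hσ, ← rp_mul, cs.simple_mul_simple_self, rp_one]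
    have hss : σ (al s) = - al s := rp_simple_self cs s
    let x' : Dual ℝ (B →₀ ℝ) := x.comp σ.toLinearMap
    have hx' : ∀ v, x' v = x (σ v) := fun v => rfl
    have hsub : σ '' (NegSet cs x') ⊂ NegSet cs x := by
      refine Set.ssubset_iff_of_subset ?_ |>.mpr ⟨al s, ⟨root_al cs s, pos_al s, hs⟩, ?_⟩
      · rintro _ ⟨β, ⟨h1, h2, h3⟩, rfl⟩
        refine ⟨root_map cs h1 _, simple_pos cs h1 h2 ?_, h3⟩
        rintro rfl
        rw [hx', hss, map_neg] at h3
        linarith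
      · rintro ⟨β, ⟨h1, h2, h3⟩, h4⟩
        have : β = - al s := by rw [← hinv β, h4, hss]
        subst this
        exact root_ne_zero cs h1 (not_both h2 (by rw [neg_neg]; exact pos_al s))
    have hinj : Function.Injective σ := σ.injective
    have hf' : (NegSet cs x').Finite :=
      Set.Finite.of_finite_image (hf.subset hsub.subset) hinj.injOn
    have hc := Set.ncard_lt_ncard hsub hf
    rw [Set.ncard_image_of_injective _ hinj] at hc
    obtain ⟨w, hw⟩ := ih _ (hn ▸ hc) x' hf' rfl
    exact ⟨cs.simple s * w, fun t => by rw [rp_mul]; exact hw t⟩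

lemma nonneg_of_pos {y : Dual ℝ (B →₀ ℝ)} (hy : ∀ s, 0 ≤ y (al s)) {v : B →₀ ℝ} (hv : Pos v) :
    0 ≤ y v := by
  have : v = v.sum fun b a => a • al b := by
    conv_lhs => rw [← Finsupp.sum_single v]
    simp [al]
  rw [this, Finsupp.sum, map_sum]
  refine Finset.sum_nonneg fun b _ => ?_
  rw [map_smul]
  exact mul_nonneg (hv b) (hy b)

/-- The height functional. -/
noncomputable def ht : Dual ℝ (B →₀ ℝ) := Finsupp.linearCombination ℝ (fun _ => (1 : ℝ))

lemma ht_pos {v : B →₀ ℝ} (hv : Pos v) (h0 : v ≠ 0) : 0 < ht v := by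
  obtain ⟨b, hb⟩ := Finsupp.ne_iff.mp h0
  rw [ht, Finsupp.linearCombination_apply, Finsupp.sum]
  refine Finset.sum_pos' (fun c _ => ?_) ⟨b, by simpa using hb, ?_⟩
  · simpa using hv c
  · simpa using lt_of_le_of_ne (hv b) (Ne.symm hb)

/-- Stabilizer of a functional. -/
def stab (y : Dual ℝ (B →₀ ℝ)) : Subgroup W where
  carrier := {u | ∀ v, y (rp cs u v) = y v}
  one_mem' := fun v => by rw [rp_one]
  mul_mem' := fun {a b} ha hb v => by rw [rp_mul, ha, hb]
  inv_mem' := fun {a} ha v => by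
    have := ha (rp cs a⁻¹ v)
    rw [← rp_mul, mul_inv_cancel, rp_one] at this
    exact this.symm

lemma mem_stab {y : Dual ℝ (B →₀ ℝ)} {u : W} : u ∈ stab cs y ↔ ∀ v, y (rp cs u v) = y v := Iff.rfl

lemma simple_mem_stab {y : Dual ℝ (B →₀ ℝ)} {s : B} (h : y (al s) = 0) :
    cs.simple s ∈ stab cs y := by
  intro v
  rw [rp_simple, sg_apply, map_sub, map_smul, h, smul_zero, sub_zero]

lemma stab_descent {y : Dual ℝ (B →₀ ℝ)} (hy : ∀ s, 0 ≤ y (al s)) {u : W} (hu : u ∈ stab cs y)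
    {s : B} (hs : cs.IsRightDescent u s) : y (al s) = 0 := by
  have h1 := nonneg_of_pos hy (neg_of_descent cs hs)
  rw [map_neg, hu] at h1
  have := hy s
  linarith

lemma stab_eq {y : Dual ℝ (B →₀ ℝ)} (hy : ∀ s, 0 ≤ y (al s)) :
    Subgroup.closure (cs.simple '' {s | y (al s) = 0}) = stab cs y := by
  apply le_antisymm
  · rw [Subgroup.closure_le]
    rintro _ ⟨s, hs, rfl⟩
    exact simple_mem_stab cs hs
  · intro u hu
    induction hn : cs.length u using Nat.strong_induction_on generalizing u with
    | _ n ih =>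
      by_cases h1 : u = 1
      · subst h1; exact one_mem _
      obtain ⟨s, hs⟩ := cs.exists_rightDescent_of_ne_one h1
      have h0 := stab_descent cs hy hu hs
      have hm := ih _ (hn ▸ hs) (mul_mem hu (simple_mem_stab cs h0)) rfl
      have := mul_mem hm (Subgroup.subset_closure (Set.mem_image_of_mem cs.simple h0))
      rwa [cs.simple_mul_simple_cancel_right] at this

lemma stab_finite {y : Dual ℝ (B →₀ ℝ)} (hy : ∀ s, 0 ≤ y (al s))
    (hf : {β | β ∈ Root cs ∧ y β = 0}.Finite) : Finite (stab cs y) := by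
  have := hf.to_subtype
  let φ : stab cs y → ({β | β ∈ Root cs ∧ y β = 0} → {β | β ∈ Root cs ∧ y β = 0}) :=
    fun u β => ⟨rp cs u.1 β.1, root_map cs β.2.1 _, by rw [u.2]; exact β.2.2⟩
  refine Finite.of_injective φ ?_
  intro u u' h
  by_contra hne
  have h1 : (u⁻¹ * u').1 ≠ 1 := by
    intro h1
    apply hne
    have : u⁻¹ * u' = 1 := Subtype.ext h1
    exact (inv_mul_eq_one.mp this)
  obtain ⟨s, hs⟩ := cs.exists_rightDescent_of_ne_one h1
  have h0 := stab_descent cs hy (u⁻¹ * u').2 hs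
  have hfix := congrArg Subtype.val (congrFun h ⟨al s, root_al cs s, h0⟩)
  change rp cs u.1 (al s) = rp cs u'.1 (al s) at hfix
  have hneg := neg_of_descent cs hs
  have e : rp cs (u⁻¹ * u').1 (al s) = al s := by
    rw [Subgroup.coe_mul, rp_mul, ← hfix, ← rp_mul, Subgroup.coe_inv, inv_mul_cancel, rp_one]
  rw [e] at hneg
  exact al_ne_zero s (not_both (pos_al s) hneg)

end GeomRep

open GeomRep in
/-- Every maximal finite subgroup `H` of a Coxeter group `W` (a finite subgroup not properly
contained in any finite subgroup) is a parabolic subgroup: `H = w W_I w⁻¹` for some `w ∈ W` and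
some `I ⊆ S` with `W_I` finite. -/
theorem stmt_12 {B W : Type*} [Group W] {M : CoxeterMatrix B} (cs : CoxeterSystem M W)
    (H : Subgroup W) (hfin : Finite ↥H)
    (hmax : ∀ K : Subgroup W, Finite ↥K → H ≤ K → K = H) :
    ∃ (w : W) (I : Set B),
      Finite ↥(Subgroup.closure (cs.simple '' I)) ∧
      H = (Subgroup.closure (cs.simple '' I)).map (MulAut.conj w).toMonoidHom := by
  classical
  have := Fintype.ofFinite H
  let x : Module.Dual ℝ (B →₀ ℝ) := ∑ h : H, ht.comp (rp cs h.1).toLinearMap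
  have hx : ∀ v, x v = ∑ h : H, ht (rp cs h.1 v) := fun v => by simp [x]
  have hinv : ∀ g ∈ H, ∀ v, x (rp cs g v) = x v := by
    intro g hg v
    rw [hx, hx]
    refine Fintype.sum_equiv (Equiv.mulRight (⟨g, hg⟩ : H)) _ _ ?_
    intro h
    simp [rp_mul]
  have hZ : {β | β ∈ Root cs ∧ Pos β ∧ x β ≤ 0}.Finite := by
    refine (Set.finite_iUnion (fun h : H => finite_inv cs h.1)).subset ?_
    rintro β ⟨h1, h2, h3⟩
    rw [Set.mem_iUnion]
    by_contra hcon
    push Not at hcon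
    have : 0 < x β := by
      rw [hx]
      refine Finset.sum_pos (fun h _ => ?_) ⟨1, Finset.mem_univ _⟩
      have hr := root_map cs h1 h.1
      refine ht_pos ((root_or cs hr).resolve_right fun hn => hcon h ⟨h1, h2, hn⟩)
        (root_ne_zero cs hr)
    linarith
  obtain ⟨w, hw⟩ := exists_dominant cs _ x
    (hZ.subset fun β h => ⟨h.1, h.2.1, h.2.2.le⟩) rfl
  let y : Module.Dual ℝ (B →₀ ℝ) := x.comp (rp cs w).toLinearMap
  have hy : ∀ v, y v = x (rp cs w v) := fun v => rfl
  have hd : ∀ s, 0 ≤ y (al s) := hw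
  have hY : {β | β ∈ Root cs ∧ y β = 0}.Finite := by
    refine Set.Finite.of_finite_image (f := rp cs w) ?_ (rp cs w).injective.injOn
    refine (hZ.union (hZ.image Neg.neg)).subset ?_
    rintro _ ⟨β, ⟨h1, h2⟩, rfl⟩
    rw [hy] at h2
    have hr := root_map cs h1 w
    rcases root_or cs hr with hp | hp
    · exact Or.inl ⟨hr, hp, h2.le⟩
    · exact Or.inr ⟨_, ⟨root_neg cs hr, hp, by rw [map_neg, h2, neg_zero]⟩, neg_neg _⟩
  have hfs := stab_finite cs hd hY
  rw [← stab_eq cs hd] at hfs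
  refine ⟨w, {s | y (al s) = 0}, hfs, ?_⟩
  symm
  apply hmax
  · exact Finite.of_surjective _ (MonoidHom.subgroupMap_surjective _ _)
  · intro h hh
    refine ⟨w⁻¹ * h * w, ?_, by simp [mul_assoc]⟩
    rw [stab_eq cs hd]
    intro v
    rw [hy, hy, ← rp_mul]
    have : w * (w⁻¹ * h * w) = h * w := by group
    rw [this, rp_mul, hinv h hh]
end
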